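/- For all integers r and t with 2 ≤ t < r, the liminf over n of n^{-t} f^{(r)}(n; 3r−2t, 3) is at least 2 / (t! · (2·C(r,t) − 1)), where C(r,t) denotes the binomial coefficient r choose t. -/

import Mathlib

open Finset Filter

/-- An `r`-graph is `(s,k)`-free if it has no `k` distinct edges spanning at most `s` vertices. -/
def IsFree {V : Type*} [DecidableEq V] (G : Finset (Finset V)) (s k : ℕ) : Prop :=
  ¬ ∃ S ⊆ G, S.card = k ∧ (S.sup id).card ≤ s

/-- `exNum r n s k` is the maximum number of edges of an `(s,k)`-free `r`-uniform
hypergraph on `n` vertices, i.e. `f^{(r)}(n; s, k)`. -/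
noncomputable def exNum (r n s k : ℕ) : ℕ :=
  sSup {m : ℕ | ∃ G : Finset (Finset (Fin n)),
    (∀ e ∈ G, e.card = r) ∧ IsFree G s k ∧ G.card = m}

namespace BES

/-- The vertex set of a block, a block being a pair of edges. -/
def vert {V : Type*} [DecidableEq V] (p : Bool → Finset V) : Finset V := p false ∪ p true

lemma subset_vert {V : Type*} [DecidableEq V] (p : Bool → Finset V) (i : Bool) :
    p i ⊆ vert p := by
  cases i
  · exact subset_union_left
  · exact subset_union_right

/-- A packing of blocks. Each block consists of two `r`-sets meeting in `t` vertices; the `t`-sets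
which are spanned by a block but lie in neither of its edges belong to the reservoir `N`. -/
structure IsPacking {V : Type*} [DecidableEq V] (r t : ℕ) (B : Finset (Bool → Finset V))
    (N : Finset (Finset V)) : Prop where
  card_edge : ∀ p ∈ B, ∀ i, (p i).card = r
  card_inter : ∀ p ∈ B, (p false ∩ p true).card = t
  card_res : ∀ T ∈ N, T.card = t
  edge_notMem : ∀ p ∈ B, ∀ i, ∀ T ⊆ p i, T ∉ N
  nonedge_mem : ∀ p ∈ B, ∀ T ⊆ vert p, T.card = t → (∀ i, ¬ T ⊆ p i) → T ∈ N
  pair : ∀ p ∈ B, ∀ p' ∈ B, p ≠ p' → ∀ i, (p i ∩ vert p').card < t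
  triple : ∀ p ∈ B, ∀ p' ∈ B, ∀ p'' ∈ B, p ≠ p' → p ≠ p'' → p' ≠ p'' → ∀ i j k,
    3 * r < (p i ∪ p' j ∪ p'' k).card + 2 * t

/-- The `t`-sets which are neither in the reservoir nor inside an edge. -/
def freeSets {V : Type*} [DecidableEq V] [Fintype V] (t : ℕ) (B : Finset (Bool → Finset V))
    (N : Finset (Finset V)) : Finset (Finset V) :=
  (powersetCard t univ).filter fun T => T ∉ N ∧ ∀ p ∈ B, ∀ i, ¬ T ⊆ p i

section Basic

variable {V : Type*} [DecidableEq V] {r t : ℕ} {B : Finset (Bool → Finset V)}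
  {N : Finset (Finset V)}

lemma IsPacking.card_vert (h : IsPacking r t B N) {p} (hp : p ∈ B) : (vert p).card + t = 2 * r := by
  have h1 := card_union_add_card_inter (p false) (p true)
  rw [h.card_inter p hp, h.card_edge p hp, h.card_edge p hp] at h1
  unfold vert; omega

lemma IsPacking.eq_of_subset (h : IsPacking r t B N) {p p'} (hp : p ∈ B) (hp' : p' ∈ B) {T}
    (hT : t ≤ T.card) {i : Bool} (hi : T ⊆ p i) (hj : T ⊆ vert p') : p = p' := by
  by_contra hne
  have := h.pair p hp p' hp' hne i
  have h2 := card_le_card (subset_inter hi hj)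
  omega

lemma IsPacking.card_edges_ge (h : IsPacking r t B N) {T} (hT : T.card = t) :
    ((B ×ˢ (univ : Finset Bool)).filter fun e => T ⊆ e.1 e.2).card ≤ 2 := by
  rcases ((B ×ˢ (univ : Finset Bool)).filter fun e => T ⊆ e.1 e.2).eq_empty_or_nonempty with h0 | h0
  · rw [h0]; simp
  · obtain ⟨⟨p, i⟩, hpi⟩ := h0
    simp only [mem_filter, mem_product, mem_univ, and_true] at hpi
    calc _ ≤ (({p} : Finset _) ×ˢ (univ : Finset Bool)).card := by
          apply card_le_card
          rintro ⟨p', j⟩ hj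
          simp only [mem_filter, mem_product, mem_univ, and_true] at hj
          simp only [mem_product, mem_singleton, mem_univ, and_true]
          exact h.eq_of_subset hj.1 hpi.1 hT.ge hj.2 (hpi.2.trans (subset_vert _ _))
      _ = 2 := by simp

variable [Fintype V]

lemma card_supersets_le (Y : Finset V) :
    ((powersetCard t (univ : Finset V)).filter fun T => Y ⊆ T).card ≤
      Fintype.card V ^ (t - Y.card) := by
  calc _ ≤ ((powersetCard (t - Y.card) (univ : Finset V)).image fun S => S ∪ Y).card := by
        apply card_le_card
        intro T hT
        simp only [mem_filter, mem_powersetCard_univ] at hT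
        simp only [mem_image, mem_powersetCard_univ]
        exact ⟨T \ Y, by rw [card_sdiff_of_subset hT.2, hT.1], sdiff_union_of_subset hT.2⟩
    _ ≤ _ := card_image_le
    _ ≤ _ := by
        rw [card_powersetCard, card_univ]
        exact Nat.choose_le_pow _ _

lemma IsPacking.card_edges_supset (h : IsPacking r t B N) (htr : t ≤ r) {Y : Finset V}
    (hY : Y.card ≤ t) :
    ((B ×ˢ (univ : Finset Bool)).filter fun e => Y ⊆ e.1 e.2).card ≤
      2 * Fintype.card V ^ (t - Y.card) := by
  classical
  have hsub : ((B ×ˢ (univ : Finset Bool)).filter fun e => Y ⊆ e.1 e.2) ⊆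
      ((powersetCard t (univ : Finset V)).filter fun T => Y ⊆ T).biUnion fun T =>
        (B ×ˢ (univ : Finset Bool)).filter fun e => T ⊆ e.1 e.2 := by
    intro e he
    simp only [mem_filter, mem_product, mem_univ, and_true] at he
    obtain ⟨T, hYT, hTe, hT⟩ := exists_subsuperset_card_eq he.2 hY
      (by rw [h.card_edge e.1 he.1]; exact htr)
    simp only [mem_biUnion, mem_filter, mem_powersetCard_univ, mem_product, mem_univ, and_true]
    exact ⟨T, ⟨hT, hYT⟩, he.1, hTe⟩
  calc _ ≤ _ := card_le_card hsub
    _ ≤ ((powersetCard t (univ : Finset V)).filter fun T => Y ⊆ T).card * 2 := by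
        apply card_biUnion_le_card_mul
        intro T hT
        simp only [mem_filter, mem_powersetCard_univ] at hT
        exact h.card_edges_ge hT.1
    _ ≤ _ := by rw [mul_comm]; exact Nat.mul_le_mul_left _ (card_supersets_le Y)

lemma IsPacking.card_le_choose (h : IsPacking r t B N) :
    B.card ≤ (Fintype.card V).choose t := by
  rw [← card_univ, ← card_powersetCard]
  apply card_le_card_of_injOn (fun p => p false ∩ p true)
  · intro p hp
    simpa using h.card_inter p hp
  · intro p hp p' hp' heq
    simp only at heq
    refine h.eq_of_subset hp hp' (T := p false ∩ p true) (h.card_inter p hp).ge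
      (i := false) inter_subset_left ?_
    rw [heq]
    exact inter_subset_left.trans (subset_vert p' false)

lemma IsPacking.card_le (h : IsPacking r t B N) : B.card ≤ Fintype.card V ^ t :=
  h.card_le_choose.trans (Nat.choose_le_pow _ _)

lemma IsPacking.choose_le (h : IsPacking r t B N) :
    (Fintype.card V).choose t ≤
      (freeSets t B N).card + N.card + B.card * (2 * r.choose t - 1) := by
  classical
  have hsub : powersetCard t (univ : Finset V) ⊆ freeSets t B N ∪ N ∪
      B.biUnion fun p => powersetCard t (p false) ∪ powersetCard t (p true) := by
    intro T hT
    by_cases h1 : T ∈ N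
    · simp [h1]
    by_cases h2 : ∀ p ∈ B, ∀ i, ¬ T ⊆ p i
    · simp only [mem_union]
      left; left
      simp only [freeSets, mem_filter]
      exact ⟨hT, h1, h2⟩
    · push Not at h2
      obtain ⟨p, hp, i, hi⟩ := h2
      simp only [mem_union, mem_biUnion, mem_powersetCard]
      right
      refine ⟨p, hp, ?_⟩
      rw [mem_powersetCard_univ] at hT
      cases i <;> simp [hi, hT]
  calc _ = (powersetCard t (univ : Finset V)).card := by rw [card_powersetCard, card_univ]
    _ ≤ _ := card_le_card hsub
    _ ≤ _ := card_union_le _ _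
    _ ≤ _ := by
        apply Nat.add_le_add (card_union_le _ _)
        apply card_biUnion_le_card_mul
        intro p hp
        have h1 := card_union_add_card_inter (powersetCard t (p false)) (powersetCard t (p true))
        have h2 : 1 ≤ (powersetCard t (p false) ∩ powersetCard t (p true)).card := by
          rw [Nat.one_le_iff_ne_zero, ← Nat.pos_iff_ne_zero, card_pos]
          refine ⟨p false ∩ p true, ?_⟩
          simp [h.card_inter p hp]
        rw [card_powersetCard, card_powersetCard, h.card_edge p hp, h.card_edge p hp] at h1
        omega

end Basic

/-- Functions whose values outside a fixed set are few are rare. -/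
lemma card_fun_image_le {P V : Type*} [Fintype P] [Fintype V] [DecidableEq P] [DecidableEq V]
    [Nonempty V] (F : Finset V) (s : ℕ) :
    ((univ : Finset (P → V)).filter fun g => (univ.image g \ F).card ≤ s).card ≤
      (s + F.card) ^ Fintype.card P * Fintype.card V ^ s := by
  classical
  have hsub : ((univ : Finset (P → V)).filter fun g => (univ.image g \ F).card ≤ s) ⊆
      (univ : Finset ((P → Fin s ⊕ F) × (Fin s → V))).image
        fun kh => fun x => Sum.elim kh.2 (fun y : F => (y : V)) (kh.1 x) := by
    intro g hg
    simp only [mem_filter, mem_univ, true_and] at hg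
    rw [mem_image]
    obtain ⟨S, hS⟩ : ∃ h : Fin s → V, ∀ y ∈ univ.image g \ F, ∃ i, h i = y := by
      obtain ⟨f⟩ : Nonempty ((univ.image g \ F : Finset V) ↪ Fin s) := by
        apply Function.Embedding.nonempty_of_card_le
        rw [Fintype.card_coe, Fintype.card_fin]; exact hg
      refine ⟨Function.extend f (fun y => (y : V)) (fun _ => Classical.arbitrary V), ?_⟩
      intro y hy
      exact ⟨f ⟨y, hy⟩, by rw [f.injective.extend_apply]⟩
    have hk : ∀ x, ∃ k : Fin s ⊕ F, Sum.elim S (fun y : F => (y : V)) k = g x := by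
      intro x
      by_cases hx : g x ∈ F
      · exact ⟨Sum.inr ⟨g x, hx⟩, rfl⟩
      · obtain ⟨i, hi⟩ := hS (g x) (by simp [hx])
        exact ⟨Sum.inl i, hi⟩
    choose k hk using hk
    exact ⟨(k, S), mem_univ _, funext hk⟩
  calc _ ≤ _ := card_le_card hsub
    _ ≤ _ := card_image_le
    _ = _ := by simp

lemma card_fun_image_le' {P V : Type*} [Fintype P] [Fintype V] [DecidableEq P] [DecidableEq V]
    [Nonempty V] (E : Finset P) (F : Finset V) (s : ℕ) :
    ((univ : Finset (P → V)).filter fun g => (E.image g \ F).card ≤ s).card ≤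
      (s + Fintype.card P + F.card) ^ Fintype.card P *
        Fintype.card V ^ (s + (Fintype.card P - E.card)) := by
  calc _ ≤ ((univ : Finset (P → V)).filter fun g => (univ.image g \ F).card ≤
        s + (Fintype.card P - E.card)).card := by
        apply card_le_card
        intro g hg
        simp only [mem_filter, mem_univ, true_and] at hg ⊢
        have : univ.image g \ F ⊆ (E.image g \ F) ∪ Eᶜ.image g := by
          intro y hy
          simp only [Finset.mem_sdiff, mem_image, mem_univ, true_and, mem_union, mem_compl] at hy ⊢
          obtain ⟨⟨x, rfl⟩, hy⟩ := hy
          by_cases hx : x ∈ E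
          · exact Or.inl ⟨⟨x, hx, rfl⟩, hy⟩
          · exact Or.inr ⟨x, hx, rfl⟩
        refine (card_le_card this).trans ((card_union_le _ _).trans ?_)
        refine Nat.add_le_add hg (card_image_le.trans ?_)
        rw [card_compl]
    _ ≤ _ := card_fun_image_le _ _
    _ ≤ _ := by
        apply Nat.mul_le_mul_right
        apply Nat.pow_le_pow_left
        omega

/-- The shape of a block: the two edges as subsets of the set of positions. -/
structure IsShape {W : Type*} [DecidableEq W] [Fintype W] (r t : ℕ) (E : Bool → Finset W) :
    Prop where
  card_edge : ∀ i, (E i).card = r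
  card_inter : (E false ∩ E true).card = t
  union_eq : E false ∪ E true = univ

/-- The block placed by a map of positions. -/
def blk {W V : Type*} [DecidableEq V] (E : Bool → Finset W) (b : W → V) : Bool → Finset V :=
  fun i => (E i).image b

/-- A map of positions whose block can be added to a packing. -/
structure Addable {W V : Type*} [DecidableEq V] [Fintype V] [DecidableEq W] [Fintype W] (r t : ℕ)
    (E : Bool → Finset W) (B : Finset (Bool → Finset V)) (N : Finset (Finset V)) (b : W → V) :
    Prop where
  inj : Function.Injective b
  free : ∀ K : Finset W, K.card = t → ∀ i, K ⊆ E i → K.image b ∈ freeSets t B N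
  res : ∀ K : Finset W, K.card = t → (∀ i, ¬ K ⊆ E i) → K.image b ∈ N
  conf : ∀ p ∈ B, ∀ p' ∈ B, p ≠ p' → ∀ i j k,
    3 * r < (blk E b i ∪ p j ∪ p' k).card + 2 * t

section

variable {W V : Type*} [DecidableEq V] [Fintype V] [DecidableEq W] [Fintype W] {r t : ℕ}
    {E : Bool → Finset W} {B : Finset (Bool → Finset V)} {N : Finset (Finset V)} {b : W → V}

lemma IsShape.card_univ (hE : IsShape r t E) : Fintype.card W + t = 2 * r := by
  have h1 := card_union_add_card_inter (E false) (E true)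
  rw [hE.card_edge, hE.card_edge, hE.card_inter, hE.union_eq, Finset.card_univ] at h1
  omega

omit [Fintype V] in
lemma IsShape.vert_blk (hE : IsShape r t E) (b : W → V) : vert (blk E b) = univ.image b := by
  unfold vert blk
  rw [← image_union, hE.union_eq]

omit [Fintype V] [DecidableEq W] [Fintype W] in
lemma exists_eq_image_of_subset {S : Finset W} {T : Finset V} (hb : Function.Injective b)
    (h : T ⊆ S.image b) : ∃ K ⊆ S, K.image b = T ∧ K.card = T.card := by
  obtain ⟨K, hK, rfl⟩ := subset_image_iff.1 h
  exact ⟨K, hK, rfl, (card_image_of_injective _ hb).symm⟩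

lemma Addable.isPacking_insert (hE : IsShape r t E) (hB : IsPacking r t B N)
    (hb : Addable r t E B N b) : IsPacking r t (insert (blk E b) B) N := by
  have hc : ∀ i, (blk E b i).card = r := fun i => by
    rw [blk, card_image_of_injective _ hb.inj, hE.card_edge]
  have hfree : ∀ T : Finset V, T.card = t → ∀ i, T ⊆ blk E b i → T ∈ freeSets t B N := by
    intro T hT i hi
    obtain ⟨K, hK, rfl, hc⟩ := exists_eq_image_of_subset hb.inj hi
    exact hb.free K (by omega) i hK
  have hres : ∀ T : Finset V, T.card = t → T ⊆ vert (blk E b) → (∀ i, ¬ T ⊆ blk E b i) →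
      T ∈ N := by
    intro T hT hv hi
    rw [hE.vert_blk] at hv
    obtain ⟨K, hK, rfl, hc⟩ := exists_eq_image_of_subset hb.inj hv
    exact hb.res K (by omega) fun i hKi => hi i (image_subset_image hKi)
  have hpair1 : ∀ p ∈ B, ∀ i, (p i ∩ vert (blk E b)).card < t := by
    intro p hp i
    by_contra! hcon
    obtain ⟨T, hT, hTc⟩ := exists_subset_card_eq hcon
    have hTp : T ⊆ p i := hT.trans inter_subset_left
    have hTb : T ⊆ vert (blk E b) := hT.trans inter_subset_right
    by_cases h : ∀ i, ¬ T ⊆ blk E b i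
    · exact hB.edge_notMem p hp i T hTp (hres T hTc hTb h)
    · push Not at h
      obtain ⟨j, hj⟩ := h
      have := hfree T hTc j hj
      simp only [freeSets, mem_filter] at this
      exact this.2.2 p hp i hTp
  have hpair2 : ∀ p ∈ B, ∀ i, (blk E b i ∩ vert p).card < t := by
    intro p hp i
    by_contra! hcon
    obtain ⟨T, hT, hTc⟩ := exists_subset_card_eq hcon
    have hTb : T ⊆ blk E b i := hT.trans inter_subset_left
    have hTp : T ⊆ vert p := hT.trans inter_subset_right
    have := hfree T hTc i hTb
    simp only [freeSets, mem_filter] at this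
    by_cases h : ∀ i, ¬ T ⊆ p i
    · exact this.2.1 (hB.nonedge_mem p hp T hTp hTc h)
    · push Not at h
      obtain ⟨j, hj⟩ := h
      exact this.2.2 p hp j hj
  refine ⟨?_, ?_, hB.card_res, ?_, ?_, ?_, ?_⟩
  · intro p hp i
    rcases mem_insert.1 hp with rfl | hp
    · exact hc i
    · exact hB.card_edge p hp i
  · intro p hp
    rcases mem_insert.1 hp with rfl | hp
    · rw [blk, blk, ← image_inter _ _ hb.inj, card_image_of_injective _ hb.inj, hE.card_inter]
    · exact hB.card_inter p hp
  · intro p hp i T hT hTN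
    rcases mem_insert.1 hp with rfl | hp
    · have := hfree T (hB.card_res T hTN) i hT
      simp only [freeSets, mem_filter] at this
      exact this.2.1 hTN
    · exact hB.edge_notMem p hp i T hT hTN
  · intro p hp T hT hTc hTi
    rcases mem_insert.1 hp with rfl | hp
    · exact hres T hTc hT hTi
    · exact hB.nonedge_mem p hp T hT hTc hTi
  · intro p hp p' hp' hne i
    rcases mem_insert.1 hp with rfl | hp <;> rcases mem_insert.1 hp' with rfl | hp'
    · exact absurd rfl hne
    · exact hpair2 p' hp' i
    · exact hpair1 p hp i
    · exact hB.pair p hp p' hp' hne i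
  · intro p hp p' hp' p'' hp'' h1 h2 h3 i j k
    rcases mem_insert.1 hp with rfl | hp
    · have hp' := (mem_insert.1 hp').resolve_left h1.symm
      have hp'' := (mem_insert.1 hp'').resolve_left h2.symm
      exact hb.conf p' hp' p'' hp'' h3 i j k
    rcases mem_insert.1 hp' with rfl | hp'
    · have hp'' := (mem_insert.1 hp'').resolve_left h3.symm
      have := hb.conf p hp p'' hp'' h2 j i k
      rwa [union_comm (p i)]
    rcases mem_insert.1 hp'' with rfl | hp''
    · have := hb.conf p hp p' hp' h1 k i j
      rwa [union_comm (p i ∪ p' j), ← union_assoc]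
    · exact hB.triple p hp p' hp' p'' hp'' h1 h2 h3 i j k

/-- A constant for counting conflicts. -/
def confConst (r v : ℕ) : ℕ := 2 * (3 * r + v) ^ v

lemma card_conf_le_of_inter [Nonempty V] (hE : IsShape r t E) {f e : Finset V}
    (hf : f.card = r) (he : e.card = r) :
    ((univ : Finset (W → V)).filter
      fun b => ∃ i, (blk E b i ∪ f ∪ e).card + 2 * t ≤ 3 * r).card ≤
      if 2 * t ≤ r + (f ∩ e).card then confConst r (Fintype.card W) *
        Fintype.card V ^ (r + (f ∩ e).card - 2 * t + (Fintype.card W - r)) else 0 := by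
  have h1 := card_union_add_card_inter f e
  split_ifs with hlt
  · calc _ ≤ ((univ : Finset Bool).biUnion fun i => (univ : Finset (W → V)).filter
          fun b => ((E i).image b \ (f ∪ e)).card ≤ r + (f ∩ e).card - 2 * t).card := by
          apply card_le_card
          intro b hb
          simp only [mem_filter, mem_univ, true_and] at hb
          obtain ⟨i, hi⟩ := hb
          simp only [mem_biUnion, mem_filter, mem_univ, true_and]
          refine ⟨i, ?_⟩
          rw [union_assoc] at hi
          have h2 := card_sdiff_add_card (blk E b i) (f ∪ e)
          change (blk E b i \ (f ∪ e)).card ≤ _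
          omega
      _ ≤ (univ : Finset Bool).card * ((3 * r + Fintype.card W) ^ Fintype.card W *
        Fintype.card V ^ (r + (f ∩ e).card - 2 * t + (Fintype.card W - r))) := by
          apply card_biUnion_le_card_mul
          intro i _
          refine (card_fun_image_le' (E i) (f ∪ e) _).trans ?_
          rw [hE.card_edge]
          apply Nat.mul_le_mul_right
          apply Nat.pow_le_pow_left
          omega
      _ = _ := by simp [confConst, mul_assoc]
  · rw [Nat.le_zero, card_eq_zero, filter_eq_empty_iff]
    rintro b - ⟨i, hi⟩
    rw [union_assoc] at hi
    have := card_le_card (subset_union_right (s₁ := blk E b i) (s₂ := f ∪ e))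
    omega

lemma IsPacking.sum_conf_le [Nonempty V] (hE : IsShape r t E) (hB : IsPacking r t B N)
    (htr : t ≤ r) {f : Finset V} (hf : f.card = r) :
    ∑ e ∈ (B ×ˢ (univ : Finset Bool)).filter (fun e => (f ∩ e.1 e.2).card < t),
      ((univ : Finset (W → V)).filter
        fun b => ∃ i, (blk E b i ∪ f ∪ e.1 e.2).card + 2 * t ≤ 3 * r).card ≤
      2 ^ r * (2 * confConst r (Fintype.card W)) * Fintype.card V ^ (Fintype.card W - t) := by
  have hv := hE.card_univ
  rw [← sum_fiberwise_of_maps_to (t := f.powerset) (g := fun e => f ∩ e.1 e.2)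
    (fun e _ => mem_powerset.2 inter_subset_left)]
  have : (2 : ℕ) ^ r = f.powerset.card := by rw [card_powerset, hf]
  rw [this, mul_assoc, ← smul_eq_mul]
  apply sum_le_card_nsmul
  intro Y hY
  by_cases hYt : Y.card < t
  · set K := if 2 * t ≤ r + Y.card then confConst r (Fintype.card W) *
        Fintype.card V ^ (r + Y.card - 2 * t + (Fintype.card W - r)) else 0 with hK
    calc _ ≤ ((B ×ˢ (univ : Finset Bool)).filter fun e => Y ⊆ e.1 e.2).card • K := by
          refine (sum_le_card_nsmul _ _ K ?_).trans ?_
          · intro e he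
            simp only [mem_filter, mem_product, mem_univ, and_true] at he
            obtain ⟨⟨he, -⟩, h2⟩ := he
            have := card_conf_le_of_inter (W := W) hE hf (hB.card_edge e.1 he e.2)
            rwa [h2] at this
          · apply Nat.mul_le_mul_right
            apply card_le_card
            intro e he
            simp only [mem_filter] at he ⊢
            exact ⟨he.1.1, he.2 ▸ inter_subset_right⟩
      _ ≤ (2 * Fintype.card V ^ (t - Y.card)) * K :=
          Nat.mul_le_mul_right _ (hB.card_edges_supset htr hYt.le)
      _ ≤ _ := by
          rw [hK]
          split_ifs with h
          · have : Fintype.card W - t =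
                (t - Y.card) + (r + Y.card - 2 * t + (Fintype.card W - r)) := by omega
            rw [this, pow_add]
            apply le_of_eq
            ring
          · simp
  · rw [filter_eq_empty_iff.2, sum_empty]
    · exact Nat.zero_le _
    · intro e he h
      simp only [mem_filter] at he
      rw [h] at he
      exact hYt he.2

/-- A constant bounding the number of placements excluded by one block. -/
def badConst (r v : ℕ) : ℕ := (v + 2 * r) ^ v + 2 * (2 ^ r * (2 * confConst r v))

lemma IsPacking.exists_extension [Nonempty V] (hE : IsShape r t E) (hB : IsPacking r t B N)
    (ht : 1 ≤ t) (htr : t ≤ r) {A : Finset (W → V)} (hA : ∀ b ∈ A, Addable r t E B N b) (k : ℕ)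
    (hk : k * (badConst r (Fintype.card W) * Fintype.card V ^ (Fintype.card W - t)) ≤ A.card) :
    ∃ B', B ⊆ B' ∧ IsPacking r t B' N ∧ B'.card = B.card + k := by
  classical
  have hv := hE.card_univ
  have hpos : 0 < badConst r (Fintype.card W) * Fintype.card V ^ (Fintype.card W - t) := by
    have : 0 < Fintype.card V := Fintype.card_pos
    unfold badConst
    have : 0 < Fintype.card W := by omega
    positivity
  induction k with
  | zero => exact ⟨B, Subset.rfl, hB, rfl⟩
  | succ k ih =>
    obtain ⟨B', hBB', hB', hcard⟩ := ih (le_trans (Nat.mul_le_mul_right _ (Nat.le_succ k)) hk)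
    set bad : Finset (W → V) := (B' \ B).biUnion fun p =>
      ((univ : Finset (W → V)).filter fun b => (univ.image b \ vert p).card ≤ Fintype.card W - t) ∪
      (univ : Finset Bool).biUnion fun j =>
        ((B' ×ˢ (univ : Finset Bool)).filter (fun e => (p j ∩ e.1 e.2).card < t)).biUnion fun e =>
          (univ : Finset (W → V)).filter
            fun b => ∃ i, (blk E b i ∪ p j ∪ e.1 e.2).card + 2 * t ≤ 3 * r with hbad
    have hbadc : bad.card ≤
        k * (badConst r (Fintype.card W) * Fintype.card V ^ (Fintype.card W - t)) := by
      have hk' : (B' \ B).card = k := by rw [card_sdiff_of_subset hBB']; omega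
      rw [hbad, ← hk']
      apply card_biUnion_le_card_mul
      intro p hp
      have hpB' := (Finset.mem_sdiff.1 hp).1
      refine (card_union_le _ _).trans ?_
      rw [badConst, add_mul]
      apply Nat.add_le_add
      · refine (card_fun_image_le (vert p) _).trans ?_
        apply Nat.mul_le_mul_right
        apply Nat.pow_le_pow_left
        have := hB'.card_vert hpB'
        omega
      · have h2 : (univ : Finset Bool).card = 2 := rfl
        rw [← h2, mul_assoc]
        apply card_biUnion_le_card_mul
        intro j _
        exact card_biUnion_le.trans (hB'.sum_conf_le hE htr (hB'.card_edge p hpB' j))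
    have : ∃ b ∈ A, b ∉ bad := by
      by_contra! hcon
      have := card_le_card (show A ⊆ bad from hcon)
      rw [Nat.succ_mul] at hk
      omega
    obtain ⟨b, hbA, hbb⟩ := this
    have hb := hA b hbA
    simp only [hbad, mem_biUnion, not_exists, mem_union, not_or, mem_filter, not_and, mem_univ,
      true_and, Finset.mem_sdiff, and_imp, mem_product, and_true, not_le, Prod.forall] at hbb
    have hov : ∀ p ∈ B', p ∉ B → (univ.image b ∩ vert p).card < t := by
      intro p hp hpB
      have h1 := (hbb p hp hpB).1
      have h2 := card_sdiff_add_card_inter (univ.image b) (vert p)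
      rw [card_image_of_injective _ hb.inj, Finset.card_univ] at h2
      omega
    have hconf : ∀ p ∈ B', p ∉ B → ∀ p' ∈ B', p ≠ p' → ∀ i j k,
        3 * r < (blk E b i ∪ p j ∪ p' k).card + 2 * t := by
      intro p hp hpB p' hp' hne i j k
      refine (hbb p hp hpB).2 j p' k hp' ?_ i
      exact (card_le_card (inter_subset_inter_left (subset_vert p' k))).trans_lt
        (hB'.pair p hp p' hp' hne j)
    have hb' : Addable r t E B' N b := by
      refine ⟨hb.inj, ?_, hb.res, ?_⟩
      · intro K hK i hKi
        have := hb.free K hK i hKi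
        simp only [freeSets, mem_filter] at this ⊢
        refine ⟨this.1, this.2.1, ?_⟩
        intro p hp j hpj
        by_cases hpB : p ∈ B
        · exact this.2.2 p hpB j hpj
        · have h1 := hov p hp hpB
          have h2 : K.image b ⊆ univ.image b ∩ vert p :=
            subset_inter (image_subset_image (subset_univ _)) (hpj.trans (subset_vert p j))
          have h3 := card_le_card h2
          rw [card_image_of_injective _ hb.inj] at h3
          omega
      · intro p hp p' hp' hne i j k
        by_cases hpB : p ∈ B
        · by_cases hpB' : p' ∈ B
          · exact hb.conf p hpB p' hpB' hne i j k
          · have := hconf p' hp' hpB' p hp hne.symm i k j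
            rwa [union_assoc, union_comm (p j), ← union_assoc]
        · exact hconf p hp hpB p' hp' hne i j k
    have hnot : blk E b ∉ B' := by
      intro hmem
      have hle : t ≤ (E false).card := by rw [hE.card_edge]; exact htr
      obtain ⟨K, hK, hKc⟩ := exists_subset_card_eq hle
      have := hb'.free K hKc false hK
      simp only [freeSets, mem_filter] at this
      exact this.2.2 _ hmem false (image_subset_image hK)
    refine ⟨insert (blk E b) B', hBB'.trans (subset_insert _ _), hb'.isPacking_insert hE hB', ?_⟩
    rw [card_insert_of_notMem hnot]
    omega

end

/-- The image of a block under an embedding. -/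
def mapBlk {V V' : Type*} (f : V ↪ V') (p : Bool → Finset V) : Bool → Finset V' :=
  fun i => (p i).map f

section Blowup

variable {U V V' : Type*} [Fintype U] [Fintype V] [DecidableEq V] [DecidableEq V']
  {r t : ℕ} {B : Finset (Bool → Finset V)} {N : Finset (Finset V)}

/-- Copies of the blocks of a packing. -/
def blowB (ι : U → V ↪ V') (B : Finset (Bool → Finset V)) : Finset (Bool → Finset V') :=
  (univ ×ˢ B).image fun x => mapBlk (ι x.1) x.2

/-- Copies of the sets of a reservoir. -/
def blowN (ι : U → V ↪ V') (N : Finset (Finset V)) : Finset (Finset V') :=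
  (univ ×ˢ N).image fun x => x.2.map (ι x.1)

/-- Embeddings of a vertex set whose ranges meet in few points. -/
structure IsSparse (t : ℕ) (ι : U → V ↪ V') : Prop where
  pair : ∀ u u', u ≠ u' → (univ.map (ι u) ∩ univ.map (ι u')).card < t
  triple : ∀ u₁ u₂ u₃, u₁ ≠ u₂ → u₁ ≠ u₃ → u₂ ≠ u₃ →
    (univ.map (ι u₁) ∩ univ.map (ι u₂)).card +
      ((univ.map (ι u₁) ∪ univ.map (ι u₂)) ∩ univ.map (ι u₃)).card < 2 * t

variable {ι : U → V ↪ V'}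

omit [Fintype U] [DecidableEq V] in
lemma IsSparse.eq_of_card_le (hι : IsSparse t ι) {u u' : U} {S S' : Finset V}
    {T : Finset V'} (hT : t ≤ T.card) (h : T ⊆ S.map (ι u)) (h' : T ⊆ S'.map (ι u')) : u = u' := by
  by_contra hne
  have h1 := hι.pair u u' hne
  have h2 := card_le_card (subset_inter (h.trans (map_subset_map.2 (subset_univ S)))
    (h'.trans (map_subset_map.2 (subset_univ S'))))
  omega

omit [Fintype V] [DecidableEq V] in
lemma mem_blowB {p : Bool → Finset V'} :
    p ∈ blowB ι B ↔ ∃ u, ∃ q ∈ B, mapBlk (ι u) q = p := by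
  simp [blowB]

omit [Fintype V] [DecidableEq V] in
lemma mem_blowN {T : Finset V'} :
    T ∈ blowN ι N ↔ ∃ u, ∃ S ∈ N, S.map (ι u) = T := by
  simp [blowN]

omit [Fintype V] in
lemma vert_mapBlk (f : V ↪ V') (p : Bool → Finset V) : vert (mapBlk f p) = (vert p).map f := by
  unfold vert mapBlk
  rw [map_union]

lemma IsSparse.card_blowB (hι : IsSparse t ι) (hB : IsPacking r t B N) (htr : t ≤ r) :
    (blowB ι B).card = Fintype.card U * B.card := by
  rw [blowB, card_image_of_injOn, card_product, card_univ]
  rintro ⟨u, p⟩ hp ⟨u', p'⟩ hp' heq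
  simp only [coe_product, Set.mem_prod, mem_coe, mem_univ, true_and] at hp hp'
  simp only at heq
  have h0 : (p false).map (ι u) = (p' false).map (ι u') := congrFun heq false
  have hu : u = u' := by
    apply hι.eq_of_card_le (T := (p false).map (ι u)) _ Subset.rfl h0.le
    rw [card_map, hB.card_edge p hp]; exact htr
  subst hu
  congr 1
  funext i
  exact map_injective _ (congrFun heq i)

omit [DecidableEq V] in
lemma IsSparse.card_blowN (hι : IsSparse t ι) (hN : ∀ T ∈ N, T.card = t) :
    (blowN ι N).card = Fintype.card U * N.card := by
  rw [blowN, card_image_of_injOn, card_product, card_univ]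
  rintro ⟨u, S⟩ hS ⟨u', S'⟩ hS' heq
  simp only [coe_product, Set.mem_prod, mem_coe, mem_univ, true_and] at hS hS'
  simp only at heq
  have hu : u = u' := by
    apply hι.eq_of_card_le (T := S.map (ι u)) _ Subset.rfl heq.le
    rw [card_map, hN S hS]
  subst hu
  congr 1
  exact map_injective _ heq

lemma card_union_union_add {α : Type*} [DecidableEq α] (a b c : Finset α) :
    (a ∪ b ∪ c).card + ((a ∩ b).card + ((a ∪ b) ∩ c).card) = a.card + b.card + c.card := by
  have h1 := card_union_add_card_inter a b
  have h2 := card_union_add_card_inter (a ∪ b) c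
  omega

lemma IsSparse.isPacking (hι : IsSparse t ι) (hB : IsPacking r t B N) :
    IsPacking r t (blowB ι B) (blowN ι N) := by
  have hpair : ∀ u u' : U, ∀ p ∈ B, ∀ p' ∈ B, mapBlk (ι u) p ≠ mapBlk (ι u') p' → ∀ i,
      (mapBlk (ι u) p i ∩ (vert p').map (ι u')).card < t := by
    intro u u' p hp p' hp' hne i
    by_cases hu : u = u'
    · subst hu
      rw [mapBlk, ← map_inter, card_map]
      exact hB.pair p hp p' hp' (fun h => hne (by rw [h])) i
    · refine (card_le_card (inter_subset_inter (map_subset_map.2 (subset_univ _))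
        (map_subset_map.2 (subset_univ _)))).trans_lt (hι.pair u u' hu)
  have htwo : ∀ u u' : U, u ≠ u' → ∀ p ∈ B, ∀ p' ∈ B, ∀ p'' ∈ B,
      mapBlk (ι u) p ≠ mapBlk (ι u) p' → ∀ i j k,
      3 * r < (mapBlk (ι u) p i ∪ mapBlk (ι u) p' j ∪ mapBlk (ι u') p'' k).card + 2 * t := by
    intro u u' hu p hp p' hp' p'' hp'' hne i j k
    have h1 := card_union_union_add (mapBlk (ι u) p i) (mapBlk (ι u) p' j) (mapBlk (ι u') p'' k)
    have h2 := (card_le_card (inter_subset_inter_left (s := mapBlk (ι u) p i)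
      (map_subset_map.2 (subset_vert p' j)))).trans_lt
      (hpair u u p hp p' hp' hne i)
    have h3 : ((mapBlk (ι u) p i ∪ mapBlk (ι u) p' j) ∩ mapBlk (ι u') p'' k).card < t := by
      refine (card_le_card (inter_subset_inter (union_subset
        (map_subset_map.2 (subset_univ (p i))) (map_subset_map.2 (subset_univ (p' j))))
        (map_subset_map.2 (subset_univ (p'' k))))).trans_lt (hι.pair u u' hu)
    have c : ∀ u (q : Bool → Finset V) i, q ∈ B → (mapBlk (ι u) q i).card = r := fun u q i hq => by
      rw [mapBlk, card_map, hB.card_edge q hq]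
    rw [c u p i hp, c u p' j hp', c u' p'' k hp''] at h1
    change (mapBlk (ι u) p i ∩ mapBlk (ι u) p' j).card < t at h2
    omega
  refine ⟨?_, ?_, ?_, ?_, ?_, ?_, ?_⟩
  · intro p hp i
    obtain ⟨u, q, hq, rfl⟩ := mem_blowB.1 hp
    rw [mapBlk, card_map, hB.card_edge q hq]
  · intro p hp
    obtain ⟨u, q, hq, rfl⟩ := mem_blowB.1 hp
    rw [mapBlk, mapBlk, ← map_inter, card_map, hB.card_inter q hq]
  · intro T hT
    obtain ⟨u, S, hS, rfl⟩ := mem_blowN.1 hT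
    rw [card_map, hB.card_res S hS]
  · intro p hp i T hT hTN
    obtain ⟨u, q, hq, rfl⟩ := mem_blowB.1 hp
    obtain ⟨u', S, hS, rfl⟩ := mem_blowN.1 hTN
    have hu : u' = u := hι.eq_of_card_le
      (by rw [card_map, hB.card_res S hS]) (Subset.refl (S.map (ι u'))) hT
    subst hu
    exact hB.edge_notMem q hq i S (map_subset_map.1 hT) hS
  · intro p hp T hT hTc hTi
    obtain ⟨u, q, hq, rfl⟩ := mem_blowB.1 hp
    rw [vert_mapBlk, subset_map_iff] at hT
    obtain ⟨S, hS, rfl⟩ := hT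
    rw [mem_blowN]
    refine ⟨u, S, hB.nonedge_mem q hq S hS (by rwa [card_map] at hTc) ?_, rfl⟩
    exact fun i hi => hTi i (map_subset_map.2 hi)
  · intro p hp p' hp' hne i
    obtain ⟨u, q, hq, rfl⟩ := mem_blowB.1 hp
    obtain ⟨u', q', hq', rfl⟩ := mem_blowB.1 hp'
    rw [vert_mapBlk]
    exact hpair u u' q hq q' hq' hne i
  · intro p hp p' hp' p'' hp'' h1 h2 h3 i j k
    obtain ⟨u, q, hq, rfl⟩ := mem_blowB.1 hp
    obtain ⟨u', q', hq', rfl⟩ := mem_blowB.1 hp'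
    obtain ⟨u'', q'', hq'', rfl⟩ := mem_blowB.1 hp''
    by_cases h12 : u = u'
    · subst h12
      by_cases h13 : u = u''
      · subst h13
        simp only [mapBlk, ← map_union, card_map]
        exact hB.triple q hq q' hq' q'' hq'' (fun h => h1 (by rw [h])) (fun h => h2 (by rw [h]))
          (fun h => h3 (by rw [h])) i j k
      · exact htwo u u'' h13 q hq q' hq' q'' hq'' h1 i j k
    by_cases h13 : u = u''
    · subst h13
      rw [union_right_comm]
      exact htwo u u' h12 q hq q'' hq'' q' hq' h2 i k j
    by_cases h23 : u' = u''
    · subst h23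
      rw [union_assoc, union_comm]
      exact htwo u' u (Ne.symm h12) q' hq' q'' hq'' q hq h3 j k i
    · have h4 := card_union_union_add (mapBlk (ι u) q i) (mapBlk (ι u') q' j) (mapBlk (ι u'') q'' k)
      have c : ∀ u (q : Bool → Finset V) i, q ∈ B → (mapBlk (ι u) q i).card = r :=
        fun u q i hq => by rw [mapBlk, card_map, hB.card_edge q hq]
      rw [c u q i hq, c u' q' j hq', c u'' q'' k hq''] at h4
      have h5 := hι.triple u u' u'' h12 h13 h23
      have s1 : mapBlk (ι u) q i ⊆ univ.map (ι u) := map_subset_map.2 (subset_univ _)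
      have s2 : mapBlk (ι u') q' j ⊆ univ.map (ι u') := map_subset_map.2 (subset_univ _)
      have s3 : mapBlk (ι u'') q'' k ⊆ univ.map (ι u'') := map_subset_map.2 (subset_univ _)
      have h6 := card_le_card (inter_subset_inter s1 s2)
      have h7 := card_le_card (inter_subset_inter (union_subset_union s1 s2) s3)
      omega

end Blowup

section Code

variable {U V Q : Type*} [Fintype V] [DecidableEq Q] {t : ℕ}

/-- Codes in which codewords agree rarely, with a stronger condition on triples of codewords. -/
structure IsCode (t : ℕ) (h : U → V → Q) : Prop where
  pair : ∀ u u', u ≠ u' → (univ.filter fun x => h u x = h u' x).card < t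
  triple : ∀ u₁ u₂ u₃, u₁ ≠ u₂ → u₁ ≠ u₃ → u₂ ≠ u₃ →
    (univ.filter fun x => h u₁ x = h u₂ x).card +
      (univ.filter fun x => h u₁ x = h u₃ x ∨ h u₂ x = h u₃ x).card < 2 * t

/-- The embedding given by a codeword and a permutation. -/
def codeEmb (h : U → V → Q) (π : U → Equiv.Perm V) (u : U) : V ↪ V × Q where
  toFun y := (π u y, h u (π u y))
  inj' _ _ hy := (π u).injective (congrArg Prod.fst hy)

variable {h : U → V → Q} {π : U → Equiv.Perm V}

omit [Fintype V] [DecidableEq Q] in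
lemma codeEmb_apply (u : U) (y : V) : codeEmb h π u y = (π u y, h u (π u y)) := rfl

omit [Fintype V] [DecidableEq Q] in
lemma mem_map_codeEmb {u : U} {x : V × Q} {S : Finset V} :
    x ∈ S.map (codeEmb h π u) ↔ (π u).symm x.1 ∈ S ∧ h u x.1 = x.2 := by
  simp only [Finset.mem_map, codeEmb_apply]
  constructor
  · rintro ⟨y, hy, rfl⟩
    simp [hy]
  · rintro ⟨h1, h2⟩
    exact ⟨_, h1, by simp [h2]⟩

omit [DecidableEq Q] in
lemma mem_map_univ_codeEmb {u : U} {x : V × Q} :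
    x ∈ univ.map (codeEmb h π u) ↔ h u x.1 = x.2 := by
  rw [mem_map_codeEmb]
  simp

variable [DecidableEq V]

lemma card_map_inter_le (u u' : U) :
    (univ.map (codeEmb h π u) ∩ univ.map (codeEmb h π u')).card ≤
      (univ.filter fun x => h u x = h u' x).card := by
  apply card_le_card_of_injOn Prod.fst
  · intro x hx
    simp only [coe_inter, Set.mem_inter_iff, mem_coe, mem_map_univ_codeEmb] at hx
    simp [hx.1, hx.2]
  · intro x hx y hy hxy
    simp only [coe_inter, Set.mem_inter_iff, mem_coe, mem_map_univ_codeEmb] at hx hy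
    exact Prod.ext hxy (by rw [← hx.1, ← hy.1, hxy])

lemma IsCode.isSparse (hc : IsCode t h) (π : U → Equiv.Perm V) : IsSparse t (codeEmb h π) := by
  refine ⟨?_, ?_⟩
  · intro u u' hne
    exact (card_map_inter_le u u').trans_lt (hc.pair u u' hne)
  · intro u₁ u₂ u₃ h12 h13 h23
    refine lt_of_le_of_lt (Nat.add_le_add (card_map_inter_le u₁ u₂) ?_) (hc.triple u₁ u₂ u₃ h12 h13 h23)
    apply card_le_card_of_injOn Prod.fst
    · intro x hx
      simp only [coe_inter, coe_union, Set.mem_inter_iff, Set.mem_union, mem_coe,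
        mem_map_univ_codeEmb] at hx
      simp only [coe_filter, mem_univ, true_and, Set.mem_ofPred_eq]
      rw [hx.2]
      exact hx.1
    · intro x hx y hy hxy
      simp only [coe_inter, coe_union, Set.mem_inter_iff, Set.mem_union, mem_coe,
        mem_map_univ_codeEmb] at hx hy
      exact Prod.ext hxy (by rw [← hx.2, ← hy.2, hxy])

end Code

section Product

variable {V : Type*} [Fintype V] {t : ℕ}

lemma card_agree_perm {Q : Type*} [DecidableEq Q] (f₁ f₂ f₃ : V → Q) :
    (univ.filter fun x => f₁ x = f₂ x).card +
      (univ.filter fun x => f₁ x = f₃ x ∨ f₂ x = f₃ x).card =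
    (univ.filter fun x => f₁ x = f₃ x).card +
      (univ.filter fun x => f₁ x = f₂ x ∨ f₃ x = f₂ x).card := by
  classical
  rw [← card_union_add_card_inter, ← filter_or, ← filter_and,
    ← card_union_add_card_inter (univ.filter fun x => f₁ x = f₃ x), ← filter_or, ← filter_and]
  refine congrArg₂ (· + ·) (congrArg card (filter_congr fun x _ => ?_))
    (congrArg card (filter_congr fun x _ => ?_)) <;> grind

lemma IsCode.prod {U Q U' Q' : Type*} [DecidableEq Q] [DecidableEq Q']
    {h : U → V → Q} {h' : U' → V → Q'} (hc : IsCode t h) (hc' : IsCode t h') :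
    IsCode t (fun (u : U × U') x => (h u.1 x, h' u.2 x)) := by
  have hmono : ∀ P P' : V → Prop, ∀ [DecidablePred P] [DecidablePred P'], (∀ x, P x → P' x) →
      (univ.filter P).card ≤ (univ.filter P').card := fun P P' _ _ hPP' =>
    card_le_card fun x hx => by
      simp only [mem_filter, mem_univ, true_and] at hx ⊢
      exact hPP' x hx
  have hpair : ∀ u u' : U × U', u ≠ u' →
      (univ.filter fun x => (h u.1 x, h' u.2 x) = (h u'.1 x, h' u'.2 x)).card < t := by
    intro u u' hne
    by_cases h1 : u.1 = u'.1
    · have h2 : u.2 ≠ u'.2 := fun h2 => hne (Prod.ext h1 h2)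
      exact (hmono _ _ fun x hx => congrArg Prod.snd hx).trans_lt (hc'.pair _ _ h2)
    · exact (hmono _ _ fun x hx => congrArg Prod.fst hx).trans_lt (hc.pair _ _ h1)
  have hsub : ∀ u₁ u₂ u₃ : U × U', u₁ ≠ u₂ → u₁.1 = u₂.1 → u₁.1 ≠ u₃.1 →
      (univ.filter fun x => (h u₁.1 x, h' u₁.2 x) = (h u₂.1 x, h' u₂.2 x)).card +
      (univ.filter fun x => (h u₁.1 x, h' u₁.2 x) = (h u₃.1 x, h' u₃.2 x) ∨
        (h u₂.1 x, h' u₂.2 x) = (h u₃.1 x, h' u₃.2 x)).card < 2 * t := by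
    intro u₁ u₂ u₃ hne h1 h2
    have h3 := hpair u₁ u₂ hne
    have h4 := (hmono (fun x => (h u₁.1 x, h' u₁.2 x) = (h u₃.1 x, h' u₃.2 x) ∨
        (h u₂.1 x, h' u₂.2 x) = (h u₃.1 x, h' u₃.2 x)) (fun x => h u₁.1 x = h u₃.1 x) (by
      rintro x (hx | hx)
      · exact congrArg Prod.fst hx
      · rw [h1]; exact congrArg Prod.fst hx)).trans_lt (hc.pair _ _ h2)
    omega
  refine ⟨hpair, ?_⟩
  intro u₁ u₂ u₃ h12 h13 h23
  by_cases a12 : u₁.1 = u₂.1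
  · by_cases a13 : u₁.1 = u₃.1
    · refine lt_of_le_of_lt (Nat.add_le_add (hmono _ _ fun x hx => congrArg Prod.snd hx)
        (hmono _ _ fun x hx => hx.imp (congrArg Prod.snd) (congrArg Prod.snd)))
        (hc'.triple u₁.2 u₂.2 u₃.2 ?_ ?_ ?_)
      · exact fun h => h12 (Prod.ext a12 h)
      · exact fun h => h13 (Prod.ext a13 h)
      · exact fun h => h23 (Prod.ext (a12.symm.trans a13) h)
    · exact hsub u₁ u₂ u₃ h12 a12 a13
  by_cases a13 : u₁.1 = u₃.1
  · rw [card_agree_perm (fun x => (h u₁.1 x, h' u₁.2 x)) (fun x => (h u₂.1 x, h' u₂.2 x))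
      (fun x => (h u₃.1 x, h' u₃.2 x))]
    exact hsub u₁ u₃ u₂ h13 a13 a12
  by_cases a23 : u₂.1 = u₃.1
  · have := hsub u₂ u₃ u₁ h23 a23 (Ne.symm a12)
    rw [← card_agree_perm (fun x => (h u₂.1 x, h' u₂.2 x)) (fun x => (h u₁.1 x, h' u₁.2 x))
      (fun x => (h u₃.1 x, h' u₃.2 x))] at this
    refine lt_of_le_of_lt (Nat.add_le_add (hmono _ _ fun x hx => hx.symm)
      (hmono _ _ fun x hx => hx.symm)) this
  · exact lt_of_le_of_lt (Nat.add_le_add (hmono _ _ fun x hx => congrArg Prod.fst hx)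
        (hmono _ _ fun x hx => hx.imp (congrArg Prod.fst) (congrArg Prod.fst)))
        (hc.triple u₁.1 u₂.1 u₃.1 a12 a13 a23)

end Product

section Markov

variable {V Z : Type*} [Fintype V] [DecidableEq V] [Fintype Z]

lemma card_cost_le (c : Z → ℕ) (q s : ℕ) (hq : 1 ≤ q) :
    ((univ : Finset (V → Z)).filter fun z => s ≤ ∑ i, c (z i)).card * q ^ s ≤
      (∑ a, q ^ c a) ^ Fintype.card V := by
  calc _ = ∑ z ∈ (univ : Finset (V → Z)).filter (fun z => s ≤ ∑ i, c (z i)), q ^ s := by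
        rw [sum_const, smul_eq_mul]
    _ ≤ ∑ z ∈ (univ : Finset (V → Z)).filter (fun z => s ≤ ∑ i, c (z i)), ∏ i, q ^ c (z i) := by
        apply sum_le_sum
        intro z hz
        rw [prod_pow_eq_pow_sum]
        exact Nat.pow_le_pow_right hq (mem_filter.1 hz).2
    _ ≤ ∑ z : V → Z, ∏ i, q ^ c (z i) := sum_le_sum_of_subset (filter_subset _ _)
    _ = ∏ _i : V, ∑ a, q ^ c a := by
        rw [prod_univ_sum, Fintype.piFinset_univ]
    _ = _ := by rw [prod_const, Finset.card_univ]

/-- A union bound: `Z` is the sample space for one coordinate, `ρ` ranges over parameters. -/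
lemma card_exists_cost_le {R : Type*} [Fintype R] (c : R → Z → ℕ)
    (q s C : ℕ) (hq : 1 ≤ q) (hC : ∀ ρ, ∑ a, q ^ c ρ a ≤ C) (D : ℕ)
    (bad : (V → Z) → Prop) [DecidablePred bad]
    (hbad : ∀ z, bad z → D ≤
      ((univ : Finset R).filter fun ρ => s ≤ ∑ i, c ρ (z i)).card) :
    D * ((univ : Finset (V → Z)).filter bad).card * q ^ s ≤
      Fintype.card R * C ^ Fintype.card V := by
  calc D * ((univ : Finset (V → Z)).filter bad).card * q ^ s
      = (∑ z ∈ (univ : Finset (V → Z)).filter bad, D) * q ^ s := by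
        rw [sum_const, smul_eq_mul, mul_comm D]
    _ ≤ (∑ z : V → Z, ((univ : Finset R).filter fun ρ => s ≤ ∑ i, c ρ (z i)).card) * q ^ s := by
        apply Nat.mul_le_mul_right
        refine (sum_le_sum fun z hz => hbad z (mem_filter.1 hz).2).trans
          (sum_le_sum_of_subset (filter_subset _ _))
    _ = (∑ ρ : R, ((univ : Finset (V → Z)).filter fun z => s ≤ ∑ i, c ρ (z i)).card) * q ^ s := by
        congr 1
        exact sum_card_bipartiteAbove_eq_sum_card_bipartiteBelow _
    _ = ∑ ρ : R, ((univ : Finset (V → Z)).filter fun z => s ≤ ∑ i, c ρ (z i)).card * q ^ s :=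
        sum_mul _ _ _
    _ ≤ ∑ _ρ : R, C ^ Fintype.card V := by
        apply sum_le_sum
        intro ρ _
        exact (card_cost_le (c ρ) q s hq).trans (Nat.pow_le_pow_left (hC ρ) _)
    _ = _ := by rw [sum_const, smul_eq_mul, Finset.card_univ]

end Markov

section Linear

variable {F : Type*} [Field F] [Fintype F] [DecidableEq F] {t : ℕ}

lemma card_dotProduct_eq_zero {k : ℕ} {w : Fin k → Fin t → F} (hw : LinearIndependent F w) :
    ((univ : Finset (Fin t → F)).filter fun a => ∀ j, a ⬝ᵥ w j = 0).card * Fintype.card F ^ k =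
      Fintype.card F ^ t := by
  classical
  set M : Matrix (Fin k) (Fin t) F := Matrix.of w with hM
  have hrank : M.rank = k := by
    have := LinearIndependent.rank_matrix (M := M) hw
    simpa using this
  have h1 := M.mulVecLin.finrank_range_add_finrank_ker
  rw [Module.finrank_fin_fun] at h1
  change M.rank + _ = t at h1
  have h2 : Nat.card (LinearMap.ker M.mulVecLin) =
      Fintype.card F ^ Module.finrank F (LinearMap.ker M.mulVecLin) := by
    rw [← Nat.card_eq_fintype_card]
    exact Module.natCard_eq_pow_finrank
  have h3 : ((univ : Finset (Fin t → F)).filter fun a => ∀ j, a ⬝ᵥ w j = 0).card =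
      Nat.card (LinearMap.ker M.mulVecLin) := by
    rw [Nat.card_eq_fintype_card, ← Fintype.card_subtype]
    apply Fintype.card_congr
    apply Equiv.subtypeEquivRight
    intro a
    rw [LinearMap.mem_ker, Matrix.mulVecLin_apply, funext_iff]
    apply forall_congr'
    intro j
    rw [dotProduct_comm]
    rfl
  rw [h3, h2, ← pow_add]
  congr 1
  omega

lemma card_dotProduct_eq {u u' : Fin t → F} (h : u ≠ u') :
    ((univ : Finset (Fin t → F)).filter fun a => a ⬝ᵥ u = a ⬝ᵥ u').card * Fintype.card F =
      Fintype.card F ^ t := by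
  have hw : LinearIndependent F ![u - u'] := by
    rw [linearIndependent_unique_iff]
    simpa [sub_eq_zero] using h
  rw [← card_dotProduct_eq_zero hw, pow_one]
  congr 2
  ext a
  simp [dotProduct_sub, sub_eq_zero]

lemma sum_pair_cost_le {u u' : Fin t → F} (h : u ≠ u') :
    ∑ a : Fin t → F, Fintype.card F ^ (if a ⬝ᵥ u = a ⬝ᵥ u' then 1 else 0) ≤
      2 * Fintype.card F ^ t := by
  calc _ ≤ ∑ a : Fin t → F, (1 + (if a ⬝ᵥ u = a ⬝ᵥ u' then 1 else 0) * Fintype.card F) := by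
        apply sum_le_sum
        intro a _
        split_ifs <;> simp
    _ = _ := by
        rw [sum_add_distrib, ← sum_mul, ← card_filter, card_dotProduct_eq h]
        simp
        ring

/-- The triple is in general position. -/
def Indep (u₁ u₂ u₃ : Fin t → F) : Prop := LinearIndependent F ![u₁ - u₂, u₁ - u₃]

lemma card_dotProduct_eq_triple {u₁ u₂ u₃ : Fin t → F} (h : Indep u₁ u₂ u₃) :
    ((univ : Finset (Fin t → F)).filter fun a => a ⬝ᵥ u₁ = a ⬝ᵥ u₂ ∧ a ⬝ᵥ u₁ = a ⬝ᵥ u₃).card *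
      Fintype.card F ^ 2 = Fintype.card F ^ t := by
  rw [← card_dotProduct_eq_zero h]
  congr 2
  ext a
  simp [dotProduct_sub, sub_eq_zero, Fin.forall_fin_two]

omit [Fintype F] [DecidableEq F] in
lemma Indep.ne {u₁ u₂ u₃ : Fin t → F} (h : Indep u₁ u₂ u₃) :
    u₁ ≠ u₂ ∧ u₁ ≠ u₃ ∧ u₂ ≠ u₃ := by
  refine ⟨?_, ?_, ?_⟩
  · rintro rfl
    exact h.ne_zero 0 (by simp)
  · rintro rfl
    exact h.ne_zero 1 (by simp)
  · rintro rfl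
    exact absurd (h.injective (a₁ := 0) (a₂ := 1) (by simp)) (by simp)

lemma pow_ite_add_ite_le {p q s : Prop} [Decidable p] [Decidable q] [Decidable s]
    (h : p → q ∨ s → q) (x : ℕ) :
    x ^ ((if p then 1 else 0) + (if q ∨ s then 1 else 0)) ≤
      1 + (if p then 1 else 0) * x + (if q then 1 else 0) * x + (if s then 1 else 0) * x +
        (if p ∧ q then 1 else 0) * x ^ 2 := by
  by_cases hp : p <;> by_cases hq : q <;> by_cases hs : s <;> simp_all

lemma sum_triple_cost_le {u₁ u₂ u₃ : Fin t → F} (h : Indep u₁ u₂ u₃) :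
    ∑ a : Fin t → F, Fintype.card F ^ ((if a ⬝ᵥ u₁ = a ⬝ᵥ u₂ then 1 else 0) +
      (if a ⬝ᵥ u₁ = a ⬝ᵥ u₃ ∨ a ⬝ᵥ u₂ = a ⬝ᵥ u₃ then 1 else 0)) ≤
      5 * Fintype.card F ^ t := by
  obtain ⟨h12, h13, h23⟩ := h.ne
  calc _ ≤ ∑ a : Fin t → F, (1 + (if a ⬝ᵥ u₁ = a ⬝ᵥ u₂ then 1 else 0) * Fintype.card F +
        (if a ⬝ᵥ u₁ = a ⬝ᵥ u₃ then 1 else 0) * Fintype.card F +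
        (if a ⬝ᵥ u₂ = a ⬝ᵥ u₃ then 1 else 0) * Fintype.card F +
        (if a ⬝ᵥ u₁ = a ⬝ᵥ u₂ ∧ a ⬝ᵥ u₁ = a ⬝ᵥ u₃ then 1 else 0) * Fintype.card F ^ 2) := by
        apply sum_le_sum
        intro a _
        have e0 : a ⬝ᵥ u₁ = a ⬝ᵥ u₂ → a ⬝ᵥ u₁ = a ⬝ᵥ u₃ ∨ a ⬝ᵥ u₂ = a ⬝ᵥ u₃ →
            a ⬝ᵥ u₁ = a ⬝ᵥ u₃ := fun h1 h2 => h2.elim id fun h2 => h1.trans h2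
        exact pow_ite_add_ite_le e0 _
    _ = _ := by
        simp only [sum_add_distrib, ← sum_mul, ← card_filter, card_dotProduct_eq h12,
          card_dotProduct_eq h13, card_dotProduct_eq h23, card_dotProduct_eq_triple h]
        simp
        ring

omit [Field F] in
lemma sum_cost_mem_le (c : (Fin t → F) → ℕ) (S : (Fin t → F) → Finset F) (hS : ∀ a, (S a).card ≤ 3)
    (C : ℕ) (hC : ∑ a, Fintype.card F ^ c a ≤ C * Fintype.card F ^ t) :
    ∑ z : (Fin t → F) × F, Fintype.card F ^ ((if z.2 ∈ S z.1 then 1 else 0) + c z.1) ≤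
      (4 * C) * Fintype.card F ^ (t + 1) := by
  rw [Fintype.sum_prod_type]
  calc _ ≤ ∑ a : Fin t → F, (4 * Fintype.card F) * Fintype.card F ^ c a := by
        apply sum_le_sum
        intro a _
        simp only [pow_add, ← sum_mul]
        apply Nat.mul_le_mul_right
        calc _ ≤ ∑ x : F, (1 + (if x ∈ S a then 1 else 0) * Fintype.card F) := by
              apply sum_le_sum
              intro x _
              split_ifs <;> simp
          _ ≤ _ := by
              rw [sum_add_distrib, ← sum_mul, ← card_filter]
              have : (univ.filter fun x => x ∈ S a).card ≤ 3 := by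
                rw [filter_mem_eq_inter, univ_inter]; exact hS a
              have := Nat.mul_le_mul_right (Fintype.card F) this
              simp only [sum_const, smul_eq_mul, Finset.card_univ, mul_one]
              linarith
    _ ≤ _ := by
        rw [← mul_sum, pow_succ]
        calc _ ≤ _ := Nat.mul_le_mul_left _ hC
          _ = _ := by ring

end Linear

/-- Positions where two codewords agree. -/
def agr {U V Q : Type*} [Fintype V] [DecidableEq Q] (h : U → V → Q) (u u' : U) : Finset V :=
  univ.filter fun i => h u i = h u' i

/-- Positions where a codeword agrees with a given word. -/
def hit {U V Q : Type*} [Fintype V] [DecidableEq Q] (h : U → V → Q) (x : V → Q) (u : U) :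
    Finset V :=
  univ.filter fun i => h u i = x i

lemma mem_agr {U V Q : Type*} [Fintype V] [DecidableEq Q] {h : U → V → Q} {u u' : U} {i : V} :
    i ∈ agr h u u' ↔ h u i = h u' i := by
  simp [agr]

lemma mem_hit {U V Q : Type*} [Fintype V] [DecidableEq Q] {h : U → V → Q} {x : V → Q} {u : U}
    {i : V} : i ∈ hit h x u ↔ h u i = x i := by
  simp [hit]

/-- Words which are not too close to the codewords. -/
structure IsGeneric {U V Q : Type*} [Fintype V] [DecidableEq V] [DecidableEq Q] (t : ℕ)
    (h : U → V → Q) (x : V → Q) : Prop where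
  one : ∀ u, (hit h x u).card ≤ t
  two : ∀ u u', u ≠ u' → (hit h x u ∪ hit h x u').card + (agr h u u').card ≤ 2 * t
  three : ∀ u₁ u₂ u₃, u₁ ≠ u₂ → u₁ ≠ u₃ → u₂ ≠ u₃ → (hit h x u₁).card < t →
    2 * t ≤ (hit h x u₁ ∪ hit h x u₂).card + (agr h u₁ u₂).card →
    ¬ 2 * t ≤ (hit h x u₁ ∪ hit h x u₃).card + (agr h u₁ u₃).card

open Classical in
lemma card_filter_le_add {V : Type*} [Fintype V] {p p' p'' : V → Prop}
    (h : ∀ x, p x → p' x ∨ p'' x) :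
    (univ.filter p).card ≤ (univ.filter p').card + (univ.filter p'').card := by
  rw [filter_congr_decidable]
  refine le_trans (card_le_card ?_) (card_union_le _ _)
  intro x hx
  simpa using h x (by simpa using hx)

section Linear

variable {F : Type*} [Field F] [Fintype F] [DecidableEq F] {t : ℕ}

/-- The codeword of a vector under a choice of evaluation vectors. -/
def lin {V : Type*} (α : V → Fin t → F) (u : Fin t → F) (i : V) : F := α i ⬝ᵥ u

omit [Fintype F] [DecidableEq F] in
lemma exists_smul_of_not_indep {u₁ u₂ u₃ : Fin t → F} (h12 : u₁ ≠ u₂)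
    (h : ¬ Indep u₁ u₂ u₃) : ∃ c : F, u₃ = u₁ - c • (u₁ - u₂) := by
  rw [Indep, LinearIndependent.pair_iff' (sub_ne_zero.2 h12)] at h
  push Not at h
  obtain ⟨c, hc⟩ := h
  exact ⟨c, by rw [hc]; abel⟩

omit [Fintype F] [DecidableEq F] in
lemma agree_of_not_indep {u₁ u₂ u₃ : Fin t → F} (h12 : u₁ ≠ u₂) (h13 : u₁ ≠ u₃) (h23 : u₂ ≠ u₃)
    (h : ¬ Indep u₁ u₂ u₃) (a : Fin t → F) :
    (a ⬝ᵥ u₁ = a ⬝ᵥ u₃ ↔ a ⬝ᵥ u₁ = a ⬝ᵥ u₂) ∧ (a ⬝ᵥ u₂ = a ⬝ᵥ u₃ ↔ a ⬝ᵥ u₁ = a ⬝ᵥ u₂) := by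
  obtain ⟨c, rfl⟩ := exists_smul_of_not_indep h12 h
  have hc0 : c ≠ 0 := by
    rintro rfl
    simp at h13
  have hc1 : c - 1 ≠ 0 := by
    intro hc
    rw [sub_eq_zero] at hc
    subst hc
    simp at h23
  simp only [dotProduct_sub, dotProduct_smul, smul_eq_mul]
  constructor
  · constructor
    · intro h
      have : c * (a ⬝ᵥ u₁ - a ⬝ᵥ u₂) = 0 := by linear_combination h
      exact sub_eq_zero.1 ((mul_eq_zero.1 this).resolve_left hc0)
    · intro h; rw [h]; ring
  · constructor
    · intro h
      have : (c - 1) * (a ⬝ᵥ u₁ - a ⬝ᵥ u₂) = 0 := by linear_combination h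
      exact sub_eq_zero.1 ((mul_eq_zero.1 this).resolve_left hc1)
    · intro h; rw [h]; ring

variable {V : Type*} [Fintype V] [DecidableEq V]

open Classical in
lemma card_bad_pair_le :
    (Fintype.card F - 1) * ((univ : Finset (V → Fin t → F)).filter fun α =>
      ∃ u u', u ≠ u' ∧ t ≤ (agr (lin α) u u').card).card * Fintype.card F ^ t ≤
    Fintype.card F ^ t * (2 * Fintype.card F ^ t) ^ Fintype.card V := by
  classical
  refine (card_exists_cost_le (R := {w : Fin t → F // (0 : Fin t → F) ≠ w})
    (fun w a => if a ⬝ᵥ 0 = a ⬝ᵥ w.1 then 1 else 0) (Fintype.card F) t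
    (2 * Fintype.card F ^ t) Fintype.card_pos (fun w => sum_pair_cost_le w.2)
    (Fintype.card F - 1) _ ?_).trans (Nat.mul_le_mul_right _ ?_)
  · rintro α ⟨u, u', hne, hcard⟩
    rw [← Fintype.card_units, ← Finset.card_univ]
    have hw : (0 : Fin t → F) ≠ u' - u := fun h => hne (sub_eq_zero.1 h.symm).symm
    apply card_le_card_of_injOn
      (fun c : Fˣ => ⟨c.1 • (u' - u), fun h => (smul_ne_zero c.ne_zero hw.symm) h.symm⟩)
    · intro c _
      simp only [coe_filter, mem_univ, true_and, Set.mem_ofPred_eq, ← card_filter]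
      refine hcard.trans (card_le_card ?_)
      intro i hi
      simp only [mem_agr, lin, mem_filter, mem_univ, true_and] at hi ⊢
      simp [dotProduct_smul, dotProduct_sub, hi]
    · intro c _ c' _ hcc
      simp only [Subtype.mk.injEq] at hcc
      exact Units.ext (smul_left_injective F hw.symm hcc)
  · refine (Fintype.card_subtype_le _).trans ?_
    simp

open Classical in
lemma card_bad_triple_le :
    (Fintype.card F - 1) * ((univ : Finset (V → Fin t → F)).filter fun α =>
      ∃ u₁ u₂ u₃, Indep u₁ u₂ u₃ ∧ 2 * t ≤ (agr (lin α) u₁ u₂).card +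
        (agr (lin α) u₁ u₃ ∪ agr (lin α) u₂ u₃).card).card * Fintype.card F ^ (2 * t) ≤
    Fintype.card F ^ (2 * t) * (5 * Fintype.card F ^ t) ^ Fintype.card V := by
  classical
  refine (card_exists_cost_le (R := {w : (Fin t → F) × (Fin t → F) // Indep 0 w.1 w.2})
    (fun w a => (if a ⬝ᵥ 0 = a ⬝ᵥ w.1.1 then 1 else 0) +
      (if a ⬝ᵥ 0 = a ⬝ᵥ w.1.2 ∨ a ⬝ᵥ w.1.1 = a ⬝ᵥ w.1.2 then 1 else 0)) (Fintype.card F) (2 * t)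
    (5 * Fintype.card F ^ t) Fintype.card_pos (fun w => sum_triple_cost_le w.2)
    (Fintype.card F - 1) _ ?_).trans (Nat.mul_le_mul_right _ ?_)
  · rintro α ⟨u₁, u₂, u₃, hI, hcard⟩
    rw [← Fintype.card_units, ← Finset.card_univ]
    have hI' : ∀ c : Fˣ, Indep 0 (c.1 • (u₂ - u₁)) (c.1 • (u₃ - u₁)) := by
      intro c
      have := hI.units_smul (fun _ => c)
      unfold Indep
      convert this using 1
      ext j k
      fin_cases j <;> simp [Units.smul_def] <;> ring
    apply card_le_card_of_injOn
      (fun c : Fˣ => ⟨(c.1 • (u₂ - u₁), c.1 • (u₃ - u₁)), hI' c⟩)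
    · intro c _
      simp only [coe_filter, mem_univ, true_and, Set.mem_ofPred_eq, sum_add_distrib, ← card_filter]
      refine hcard.trans (Nat.add_le_add (card_le_card ?_) (card_le_card ?_))
      · intro i hi
        simp only [mem_agr, lin, mem_filter, mem_univ, true_and] at hi ⊢
        simp [dotProduct_smul, dotProduct_sub, hi]
      · intro i hi
        simp only [mem_agr, lin, mem_filter, mem_univ, true_and, mem_union] at hi ⊢
        rcases hi with hi | hi
        · left; simp [dotProduct_smul, dotProduct_sub, hi]
        · right; simp [dotProduct_smul, dotProduct_sub, hi]
    · intro c _ c' _ hcc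
      simp only [Subtype.mk.injEq, Prod.mk.injEq] at hcc
      exact Units.ext (smul_left_injective F (sub_ne_zero.2 hI.ne.1.symm) hcc.1)
  · refine (Fintype.card_subtype_le _).trans ?_
    rw [Fintype.card_prod]
    simp [two_mul, pow_add]

omit [Fintype F] in
lemma bad_of_not_isCode {α : V → Fin t → F} (h : ¬ IsCode t (lin α)) :
    (∃ u u', u ≠ u' ∧ t ≤ (agr (lin α) u u').card) ∨
    ∃ u₁ u₂ u₃, Indep u₁ u₂ u₃ ∧ 2 * t ≤ (agr (lin α) u₁ u₂).card +
        (agr (lin α) u₁ u₃ ∪ agr (lin α) u₂ u₃).card := by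
  contrapose! h
  obtain ⟨h1, h2⟩ := h
  refine ⟨h1, ?_⟩
  intro u₁ u₂ u₃ h12 h13 h23
  by_cases hI : Indep u₁ u₂ u₃
  · have := h2 u₁ u₂ u₃ hI
    rwa [agr, agr, agr, ← filter_or] at this
  · have h3 := h1 u₁ u₂ h12
    have : (univ.filter fun i => lin α u₁ i = lin α u₃ i ∨ lin α u₂ i = lin α u₃ i) =
        agr (lin α) u₁ u₂ := by
      apply filter_congr
      intro i _
      have := agree_of_not_indep h12 h13 h23 hI (α i)
      simp only [lin]
      rw [this.1, this.2, or_self]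
    rw [this]
    change (agr (lin α) u₁ u₂).card + _ < _
    omega

open Classical in
lemma card_not_isCode_le :
    (Fintype.card F - 1) * ((univ : Finset (V → Fin t → F)).filter fun α =>
      ¬ IsCode t (lin α)).card ≤
    2 * 5 ^ Fintype.card V * Fintype.card F ^ (t * Fintype.card V) := by
  classical
  have hq : 0 < Fintype.card F := Fintype.card_pos
  have h1 := card_bad_pair_le (F := F) (t := t) (V := V)
  have h2 := card_bad_triple_le (F := F) (t := t) (V := V)
  rw [mul_comm (_ ^ t)] at h1
  rw [mul_comm (_ ^ (2 * t))] at h2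
  have h1 := Nat.le_of_mul_le_mul_right h1 (by positivity)
  have h2 := Nat.le_of_mul_le_mul_right h2 (by positivity)
  have h3 := card_filter_le_add (V := V → Fin t → F) (fun α => bad_of_not_isCode (t := t) (α := α))
  have h4 : ∀ c, c ≤ 5 → (c * Fintype.card F ^ t) ^ Fintype.card V ≤
      5 ^ Fintype.card V * Fintype.card F ^ (t * Fintype.card V) := by
    intro c hc
    rw [pow_mul, ← mul_pow]
    exact Nat.pow_le_pow_left (Nat.mul_le_mul_right _ hc) _
  have h5 : ∀ a b c n x : ℕ, a * b ≤ x → a * c ≤ x → n ≤ b + c → a * n ≤ 2 * x := by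
    intro a b c n x hb hc hn
    have := Nat.mul_le_mul_left a hn
    linarith
  rw [mul_assoc 2]
  refine h5 _ _ _ _ _ (h1.trans (h4 2 (by norm_num))) (h2.trans (h4 5 le_rfl)) ?_
  convert h3

end Linear

section

variable {F : Type*} [Field F] [Fintype F] [DecidableEq F] {t : ℕ}
variable {V : Type*} [Fintype V] [DecidableEq V]

omit [Fintype V] [DecidableEq V] in
open Classical in
lemma card_filter_mul_le_four [Fintype V] {p p₁ p₂ p₃ p₄ : V → Prop} {q X : ℕ}
    (h₁ : (univ.filter p₁).card * q ≤ X) (h₂ : (univ.filter p₂).card * q ≤ X)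
    (h₃ : (univ.filter p₃).card * q ≤ X) (h₄ : (univ.filter p₄).card * q ≤ X)
    (h : ∀ x, p x → (p₁ x ∨ p₂ x) ∨ (p₃ x ∨ p₄ x)) :
    (univ.filter p).card * q ≤ 4 * X := by
  have h5 := card_filter_le_add h
  have h6 := card_filter_le_add (p := fun x => p₁ x ∨ p₂ x) fun x hx => hx
  have h7 := card_filter_le_add (p := fun x => p₃ x ∨ p₄ x) fun x hx => hx
  have := Nat.mul_le_mul_right q (h5.trans (Nat.add_le_add h6 h7))
  linarith

open Classical in
lemma card_far_le {R : Type*} [Fintype R] (P : R → Prop) (c : R → (Fin t → F) → ℕ)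
    (S : R → (Fin t → F) → Finset F) (hS : ∀ ρ a, (S ρ a).card ≤ 3)
    (hC : ∀ ρ, P ρ → ∑ a, Fintype.card F ^ c ρ a ≤ 5 * Fintype.card F ^ t) (s : ℕ)
    (hR : Fintype.card R * Fintype.card F ≤ Fintype.card F ^ s)
    (bad : (V → (Fin t → F) × F) → Prop)
    (hbad : ∀ z, bad z → ∃ ρ, P ρ ∧
      s ≤ (univ.filter fun i => (z i).2 ∈ S ρ (z i).1).card + ∑ i, c ρ (z i).1) :
    (univ.filter bad).card * Fintype.card F ≤
      20 ^ Fintype.card V * Fintype.card F ^ ((t + 1) * Fintype.card V) := by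
  have hq : 0 < Fintype.card F := Fintype.card_pos
  have h1 := card_exists_cost_le (R := {ρ // P ρ}) (V := V)
    (fun ρ (z : (Fin t → F) × F) => (if z.2 ∈ S ρ z.1 then 1 else 0) + c ρ z.1) (Fintype.card F) s
    ((4 * 5) * Fintype.card F ^ (t + 1)) hq
    (fun ρ => sum_cost_mem_le (c ρ) (S ρ) (hS ρ) 5 (hC ρ.1 ρ.2)) 1 bad (by
      intro z hz
      obtain ⟨ρ, hρ, h⟩ := hbad z hz
      rw [Nat.one_le_iff_ne_zero, ← Nat.pos_iff_ne_zero, card_pos]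
      refine ⟨⟨ρ, hρ⟩, ?_⟩
      simpa only [mem_filter, mem_univ, true_and, sum_add_distrib, ← card_filter] using h)
  have h2 : Fintype.card {ρ // P ρ} * Fintype.card F ≤ Fintype.card F ^ s :=
    (Nat.mul_le_mul_right _ (Fintype.card_subtype_le _)).trans hR
  have h3 : (4 * 5 * Fintype.card F ^ (t + 1)) ^ Fintype.card V =
    20 ^ Fintype.card V * Fintype.card F ^ ((t + 1) * Fintype.card V) := by
    rw [mul_pow, ← pow_mul]
  rw [h3, one_mul] at h1
  set X := 20 ^ Fintype.card V * Fintype.card F ^ ((t + 1) * Fintype.card V)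
  refine Nat.le_of_mul_le_mul_right (c := Fintype.card F ^ s) ?_ (by positivity)
  calc _ = _ * Fintype.card F ^ s * Fintype.card F := by ring
    _ ≤ Fintype.card {ρ // P ρ} * X * Fintype.card F := Nat.mul_le_mul_right _ h1
    _ = X * (Fintype.card {ρ // P ρ} * Fintype.card F) := by ring
    _ ≤ _ := Nat.mul_le_mul_left _ h2

lemma exists_of_three {U Q : Type*} [DecidableEq Q] {h : U → V → Q} {x : V → Q} {u₁ u₂ u₃ : U}
    (h1 : (hit h x u₁).card < t)
    (h2 : 2 * t ≤ (hit h x u₁ ∪ hit h x u₂).card + (agr h u₁ u₂).card)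
    (h3 : 2 * t ≤ (hit h x u₁ ∪ hit h x u₃).card + (agr h u₁ u₃).card) :
    3 * t + 1 ≤ (hit h x u₁ ∪ hit h x u₂ ∪ hit h x u₃).card +
      ((agr h u₁ u₂).card + (agr h u₁ u₃ ∪ agr h u₂ u₃).card) := by
  have e1 := card_union_add_card_inter (hit h x u₁ ∪ hit h x u₂) (hit h x u₁ ∪ hit h x u₃)
  have e2 : (hit h x u₁ ∪ hit h x u₂) ∪ (hit h x u₁ ∪ hit h x u₃) =
      hit h x u₁ ∪ hit h x u₂ ∪ hit h x u₃ := by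
    ext; simp only [mem_union]; tauto
  have e3 : (hit h x u₁ ∪ hit h x u₂) ∩ (hit h x u₁ ∪ hit h x u₃) ⊆
      hit h x u₁ ∪ ((agr h u₁ u₃ ∪ agr h u₂ u₃) \ agr h u₁ u₃) := by
    intro i
    simp only [mem_inter, mem_union, Finset.mem_sdiff, mem_hit, mem_agr]
    grind
  have e4 := (card_le_card e3).trans (card_union_le _ _)
  have e5 := card_sdiff_add_card_eq_card
    (subset_union_left (s₁ := agr h u₁ u₃) (s₂ := agr h u₂ u₃))
  rw [e2] at e1
  omega

lemma exists_of_three_collinear {U Q : Type*} [DecidableEq Q] {h : U → V → Q} {x : V → Q}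
    {u₁ u₂ u₃ : U}
    (h1 : (hit h x u₁).card < t) (hc : (agr h u₁ u₂).card < t)
    (e13 : agr h u₁ u₃ = agr h u₁ u₂) (e23 : agr h u₂ u₃ = agr h u₁ u₂)
    (h2 : 2 * t ≤ (hit h x u₁ ∪ hit h x u₂).card + (agr h u₁ u₂).card)
    (h3 : 2 * t ≤ (hit h x u₁ ∪ hit h x u₃).card + (agr h u₁ u₃).card) :
    2 * t + 2 ≤ (hit h x u₁ ∪ hit h x u₂ ∪ hit h x u₃).card + (agr h u₁ u₂).card := by
  have := exists_of_three h1 h2 h3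
  have e1 := card_union_add_card_inter (hit h x u₁ ∪ hit h x u₂) (hit h x u₁ ∪ hit h x u₃)
  have e2 : (hit h x u₁ ∪ hit h x u₂) ∪ (hit h x u₁ ∪ hit h x u₃) =
      hit h x u₁ ∪ hit h x u₂ ∪ hit h x u₃ := by
    ext; simp only [mem_union]; tauto
  have e3 : (hit h x u₁ ∪ hit h x u₂) ∩ (hit h x u₁ ∪ hit h x u₃) ⊆
      hit h x u₁ ∪ (agr h u₂ u₃ \ agr h u₁ u₃) := by
    intro i
    simp only [mem_inter, mem_union, Finset.mem_sdiff, mem_hit, mem_agr]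
    grind
  rw [e13, e23, Finset.sdiff_self, union_empty] at e3
  have e4 := card_le_card e3
  rw [e2] at e1
  rw [e13] at h3
  omega

open Classical in
lemma card_not_isGeneric_le :
    ((univ : Finset (V → (Fin t → F) × F)).filter fun z => IsCode t (lin fun i => (z i).1) ∧
      ¬ IsGeneric t (lin fun i => (z i).1) (fun i => (z i).2)).card * Fintype.card F ≤
    4 * (20 ^ Fintype.card V * Fintype.card F ^ ((t + 1) * Fintype.card V)) := by
  have hF : Fintype.card (Fin t → F) = Fintype.card F ^ t := by simp
  have hq : 0 < Fintype.card F := Fintype.card_pos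
  have B1 := card_far_le (F := F) (V := V) (t := t) (R := Fin t → F) (fun _ => True) (fun _ _ => 0)
    (fun u a => {a ⬝ᵥ u}) (by simp) (by intro ρ _; simp; omega) (t + 1)
    (by rw [hF, pow_succ]) (fun z => ∃ u, t + 1 ≤
      (hit (lin fun i => (z i).1) (fun i => (z i).2) u).card) (by
      rintro z ⟨u, hu⟩
      refine ⟨u, trivial, hu.trans (le_trans (card_le_card ?_) (Nat.le_add_right _ _))⟩
      intro i hi
      simp only [mem_hit, lin] at hi
      simp [hi])
  have B2 := card_far_le (F := F) (V := V) (t := t) (R := (Fin t → F) × (Fin t → F))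
    (fun u => u.1 ≠ u.2) (fun u a => if a ⬝ᵥ u.1 = a ⬝ᵥ u.2 then 1 else 0)
    (fun u a => {a ⬝ᵥ u.1, a ⬝ᵥ u.2}) (fun u a => card_le_two.trans (by norm_num))
    (fun u hu => (sum_pair_cost_le hu).trans (Nat.mul_le_mul_right _ (by norm_num))) (2 * t + 1)
    (by rw [Fintype.card_prod, hF, ← pow_add, ← pow_succ, two_mul]) (fun z => ∃ u u', u ≠ u' ∧
      2 * t + 1 ≤ (hit (lin fun i => (z i).1) (fun i => (z i).2) u ∪
        hit (lin fun i => (z i).1) (fun i => (z i).2) u').card +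
        (agr (lin fun i => (z i).1) u u').card) (by
      rintro z ⟨u, u', hne, hu⟩
      refine ⟨(u, u'), hne, hu.trans (Nat.add_le_add (card_le_card ?_) ?_)⟩
      · intro i hi
        simp only [mem_hit, lin, mem_union] at hi
        rcases hi with hi | hi <;> simp [hi]
      · rw [← card_filter]; rfl)
  have B3 := card_far_le (F := F) (V := V) (t := t) (R := (Fin t → F) × (Fin t → F) × (Fin t → F))
    (fun u => Indep u.1 u.2.1 u.2.2) (fun u a => (if a ⬝ᵥ u.1 = a ⬝ᵥ u.2.1 then 1 else 0) +
      (if a ⬝ᵥ u.1 = a ⬝ᵥ u.2.2 ∨ a ⬝ᵥ u.2.1 = a ⬝ᵥ u.2.2 then 1 else 0))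
    (fun u a => {a ⬝ᵥ u.1, a ⬝ᵥ u.2.1, a ⬝ᵥ u.2.2}) (fun u a => card_le_three)
    (fun u hu => sum_triple_cost_le hu) (3 * t + 1)
    (by
      rw [Fintype.card_prod, Fintype.card_prod, hF, ← pow_add, ← pow_add, ← pow_succ]
      apply le_of_eq; congr 1; ring)
    (fun z => ∃ u₁ u₂ u₃, Indep u₁ u₂ u₃ ∧ 3 * t + 1 ≤
      (hit (lin fun i => (z i).1) (fun i => (z i).2) u₁ ∪
        hit (lin fun i => (z i).1) (fun i => (z i).2) u₂ ∪
        hit (lin fun i => (z i).1) (fun i => (z i).2) u₃).card +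
        ((agr (lin fun i => (z i).1) u₁ u₂).card +
        (agr (lin fun i => (z i).1) u₁ u₃ ∪ agr (lin fun i => (z i).1) u₂ u₃).card)) (by
      rintro z ⟨u₁, u₂, u₃, hI, hu⟩
      refine ⟨(u₁, u₂, u₃), hI, hu.trans (Nat.add_le_add (card_le_card ?_) ?_)⟩
      · intro i hi
        simp only [mem_hit, lin, mem_union] at hi
        have hi := hi.imp (Or.imp Eq.symm Eq.symm) Eq.symm
        simp only [mem_filter, mem_univ, true_and, mem_insert, mem_singleton]
        tauto
      · rw [sum_add_distrib, ← card_filter, ← card_filter, filter_or]; rfl)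
  have B4 := card_far_le (F := F) (V := V) (t := t) (R := (Fin t → F) × (Fin t → F) × F)
    (fun u => u.1 ≠ u.2.1) (fun u a => if a ⬝ᵥ u.1 = a ⬝ᵥ u.2.1 then 1 else 0)
    (fun u a => {a ⬝ᵥ u.1, a ⬝ᵥ u.2.1, a ⬝ᵥ (u.1 - u.2.2 • (u.1 - u.2.1))})
    (fun u a => card_le_three)
    (fun u hu => (sum_pair_cost_le hu).trans (Nat.mul_le_mul_right _ (by norm_num))) (2 * t + 2)
    (by
      rw [Fintype.card_prod, Fintype.card_prod, hF, ← pow_succ, ← pow_add, ← pow_succ]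
      apply le_of_eq; congr 1; ring)
    (fun z => ∃ u₁ u₂, ∃ c : F, u₁ ≠ u₂ ∧ 2 * t + 2 ≤
      (hit (lin fun i => (z i).1) (fun i => (z i).2) u₁ ∪
        hit (lin fun i => (z i).1) (fun i => (z i).2) u₂ ∪
        hit (lin fun i => (z i).1) (fun i => (z i).2) (u₁ - c • (u₁ - u₂))).card +
        (agr (lin fun i => (z i).1) u₁ u₂).card) (by
      rintro z ⟨u₁, u₂, c, hne, hu⟩
      refine ⟨(u₁, u₂, c), hne, hu.trans (Nat.add_le_add (card_le_card ?_) ?_)⟩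
      · intro i hi
        simp only [mem_hit, lin, mem_union] at hi
        have hi := hi.imp (Or.imp Eq.symm Eq.symm) Eq.symm
        simp only [mem_filter, mem_univ, true_and, mem_insert, mem_singleton]
        tauto
      · rw [← card_filter]; rfl)
  have key := card_filter_mul_le_four (p := fun z => IsCode t (lin fun i => (z i).1) ∧
      ¬ IsGeneric t (lin fun i => (z i).1) (fun i => (z i).2)) B1 B2 B3 B4 ?_
  · convert key
  · rintro z ⟨hc, hg⟩
    by_contra! hcon
    obtain ⟨⟨b1, b2⟩, b3, b4⟩ := hcon
    apply hg
    refine ⟨?_, ?_, ?_⟩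
    · intro u
      have := b1 u
      omega
    · intro u u' hne
      have := b2 u u' hne
      omega
    · intro u₁ u₂ u₃ h12 h13 h23 h1 h2 h3
      by_cases hI : Indep u₁ u₂ u₃
      · have := b3 u₁ u₂ u₃ hI
        have := exists_of_three h1 h2 h3
        omega
      · have hag := agree_of_not_indep h12 h13 h23 hI
        have := exists_of_three_collinear h1 (hc.pair u₁ u₂ h12)
          (filter_congr fun i _ => (hag _).1) (filter_congr fun i _ => (hag _).2) h2 h3
        obtain ⟨c, rfl⟩ := exists_smul_of_not_indep h12 hI
        have := b4 u₁ u₂ c h12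
        omega

end

section

variable {F : Type*} [Field F] [Fintype F] [DecidableEq F] {t : ℕ}
variable {V : Type*} [Fintype V] [DecidableEq V]

open Classical in
lemma exists_good_code (t : ℕ) (hq : 33 * 20 ^ Fintype.card V ≤ Fintype.card F) :
    ∃ α : V → Fin t → F, IsCode t (lin α) ∧
      4 * ((univ : Finset (V → F)).filter fun x => ¬ IsGeneric t (lin α) x).card ≤
        Fintype.card F ^ Fintype.card V := by
  by_contra! hcon
  have hq0 : 0 < Fintype.card F := Fintype.card_pos
  have h1 := card_not_isCode_le (F := F) (V := V) (t := t)
  have h2 := card_not_isGeneric_le (F := F) (V := V) (t := t)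
  set q := Fintype.card F
  set m := Fintype.card V
  set G := (univ : Finset (V → Fin t → F)).filter fun α => IsCode t (lin α) with hG
  set a := ((univ : Finset (V → Fin t → F)).filter fun α => ¬ IsCode t (lin α)).card
  have h3 : G.card + a = q ^ (t * m) := by
    rw [card_filter_add_card_filter_not, card_univ, Fintype.card_fun, Fintype.card_fun,
      Fintype.card_fin, ← pow_mul]
  have h4 : 2 * a ≤ q ^ (t * m) := by
    have h5 : 4 * 5 ^ m ≤ q - 1 := by
      have : 5 ^ m ≤ 20 ^ m := Nat.pow_le_pow_left (by norm_num) _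
      have : 0 < 20 ^ m := by positivity
      omega
    have h6 := (Nat.mul_le_mul_right a h5).trans h1
    have : 0 < 2 * 5 ^ m := by positivity
    refine Nat.le_of_mul_le_mul_left (c := 2 * 5 ^ m) ?_ this
    linarith
  have h5 : G.card * q ^ m ≤ 4 * ((univ : Finset (V → (Fin t → F) × F)).filter fun z =>
      IsCode t (lin fun i => (z i).1) ∧
      ¬ IsGeneric t (lin fun i => (z i).1) (fun i => (z i).2)).card := by
    have h6 : ∑ α ∈ G, ((univ : Finset (V → F)).filter fun x => ¬ IsGeneric t (lin α) x).card =
        ((univ : Finset (V → (Fin t → F) × F)).filter fun z =>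
      IsCode t (lin fun i => (z i).1) ∧
      ¬ IsGeneric t (lin fun i => (z i).1) (fun i => (z i).2)).card := by
      rw [← card_sigma]
      refine card_bij' (fun y _ i => (y.1 i, y.2 i)) (fun z _ => ⟨fun i => (z i).1, fun i => (z i).2⟩)
        ?_ ?_ ?_ ?_
      · rintro ⟨α, x⟩ h
        simpa [hG] using h
      · intro z h
        simpa [hG] using h
      · intros; rfl
      · intros; rfl
    rw [← h6, mul_sum, ← smul_eq_mul, ← sum_const]
    refine sum_le_sum fun α hα => (hcon α ?_).le
    simpa [hG] using hα
  have h6 : q ^ ((t + 1) * m) * q ≤ q ^ ((t + 1) * m) * (32 * 20 ^ m) := by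
    calc q ^ ((t + 1) * m) * q = q ^ (t * m) * q ^ m * q := by ring
      _ ≤ (2 * G.card) * q ^ m * q := by gcongr; omega
      _ ≤ 8 * ((univ : Finset (V → (Fin t → F) × F)).filter fun z =>
      IsCode t (lin fun i => (z i).1) ∧
      ¬ IsGeneric t (lin fun i => (z i).1) (fun i => (z i).2)).card * q := by
          gcongr ?_ * q
          linarith
      _ ≤ 8 * (4 * (20 ^ m * q ^ ((t + 1) * m))) := by
          rw [mul_assoc]
          gcongr
      _ = _ := by ring
  have h7 := Nat.le_of_mul_le_mul_left h6 (by positivity)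
  have : 0 < 20 ^ m := by positivity
  omega

end

section Prob

open Classical in
/-- The proportion of the elements of a finite type which satisfy a predicate. -/
noncomputable def pr {Ω : Type*} [Fintype Ω] (P : Ω → Prop) : ℝ :=
  ((univ.filter P).card : ℝ) / Fintype.card Ω

variable {Ω : Type*} [Fintype Ω] {P P' : Ω → Prop}

lemma pr_eq [DecidablePred P] : pr P = ((univ.filter P).card : ℝ) / Fintype.card Ω := by
  unfold pr
  congr!

lemma pr_nonneg : 0 ≤ pr P := by unfold pr; positivity

lemma pr_mono (h : ∀ ω, P ω → P' ω) : pr P ≤ pr P' := by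
  unfold pr
  gcongr with ω
  exact h ω

lemma pr_not [Nonempty Ω] : pr (fun ω => ¬ P ω) = 1 - pr P := by
  classical
  rw [pr_eq, pr_eq]
  have h := card_filter_add_card_filter_not (s := (univ : Finset Ω)) P
  have h0 : (Fintype.card Ω : ℝ) ≠ 0 := by simp
  rw [card_univ] at h
  rw [eq_sub_iff_add_eq, ← add_div, div_eq_one_iff_eq h0, add_comm]
  exact_mod_cast h

section Pi

variable {U X : Type*} [Fintype U] [DecidableEq U] [Fintype X] {P P' : (U → X) → Prop}

lemma pr_and_of_dependsOn [Nonempty X] {S S' : Finset U} (hP : DependsOn P (S : Set U))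
    (hP' : DependsOn P' (S' : Set U)) (hd : Disjoint S S') :
    pr (fun ω => P ω ∧ P' ω) = pr P * pr P' := by
  classical
  have key : ((univ.filter fun ω => P ω ∧ P' ω) ×ˢ (univ : Finset (U → X))).card =
      ((univ.filter P) ×ˢ (univ.filter P')).card := by
    have e1 : ∀ a b : U → X, P (S.piecewise a b) = P a := fun a b => hP fun i hi => by
      simp [Finset.piecewise, mem_coe.1 hi]
    have e2 : ∀ a b : U → X, P' (S.piecewise a b) = P' b := fun a b => hP' fun i hi => by
      have : i ∉ S := fun h => Finset.disjoint_left.1 hd h hi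
      simp [Finset.piecewise, this]
    refine card_bij' (fun x _ => (S.piecewise x.1 x.2, S.piecewise x.2 x.1))
      (fun x _ => (S.piecewise x.1 x.2, S.piecewise x.2 x.1)) ?_ ?_ ?_ ?_
    · rintro ⟨a, b⟩ h
      simpa [e1, e2] using h
    · rintro ⟨a, b⟩ h
      simpa [e1, e2] using h
    · rintro ⟨a, b⟩ h
      ext i <;> by_cases hi : i ∈ S <;> simp [hi]
    · rintro ⟨a, b⟩ h
      ext i <;> by_cases hi : i ∈ S <;> simp [hi]
  rw [card_product, card_product, card_univ] at key
  rw [pr_eq, pr_eq, pr_eq]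
  have h0 : (Fintype.card (U → X) : ℝ) ≠ 0 := by
    exact_mod_cast Fintype.card_ne_zero
  rw [div_mul_div_comm, div_eq_div_iff h0 (mul_ne_zero h0 h0), ← mul_assoc]
  congr 1
  exact_mod_cast key

lemma pr_forall_of_dependsOn [Nonempty X] {ι : Type*} (I : Finset ι)
    (A : ι → (U → X) → Prop) (S : ι → Finset U) (hA : ∀ i ∈ I, DependsOn (A i) (S i : Set U))
    (hd : ∀ i ∈ I, ∀ j ∈ I, i ≠ j → Disjoint (S i) (S j)) :
    pr (fun ω => ∀ i ∈ I, A i ω) = ∏ i ∈ I, pr (A i) := by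
  classical
  induction I using Finset.induction_on with
  | empty => simp [pr]
  | insert a I ha ih =>
    rw [prod_insert ha, ← ih (fun i hi => hA i (mem_insert_of_mem hi))
      (fun i hi j hj => hd i (mem_insert_of_mem hi) j (mem_insert_of_mem hj)),
      ← pr_and_of_dependsOn (S' := I.biUnion S) (hA a (mem_insert_self _ _)) ?_ ?_]
    · simp only [forall_mem_insert]
    · intro x y hxy
      simp only [eq_iff_iff]
      refine forall₂_congr fun i hi => ?_
      rw [hA i (mem_insert_of_mem hi) fun u hu => hxy u ?_]
      exact mem_coe.2 (mem_biUnion.2 ⟨i, hi, hu⟩)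
    · rw [disjoint_biUnion_right]
      intro i hi
      exact hd a (mem_insert_self _ _) i (mem_insert_of_mem hi) (by rintro rfl; exact ha hi)

lemma pr_eval [Nonempty X] (u : U) (Q : X → Prop) : pr (fun ω : U → X => Q (ω u)) = pr Q := by
  classical
  have h : (univ.filter fun ω : U → X => Q (ω u)) =
      Fintype.piFinset fun v => if v = u then univ.filter Q else univ := by
    ext ω
    simp only [mem_filter, mem_univ, true_and, Fintype.mem_piFinset]
    constructor
    · intro h v
      split_ifs with hv
      · subst hv; simpa using h
      · simp
    · intro h
      simpa using h u
  unfold pr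
  rw [h, Fintype.card_piFinset, ← mul_prod_erase univ _ (mem_univ u), if_pos rfl,
    prod_congr rfl (g := fun _ => Fintype.card X)
      (fun v hv => by rw [if_neg (ne_of_mem_erase hv), card_univ]), prod_const,
      card_erase_of_mem (mem_univ u), card_univ, Fintype.card_fun]
  have h0 : (Fintype.card X : ℝ) ≠ 0 := by simp
  have h1 : Fintype.card X ^ Fintype.card U =
      Fintype.card X * Fintype.card X ^ (Fintype.card U - 1) := by
    rw [← pow_succ']
    congr 1
    have : 0 < Fintype.card U := Fintype.card_pos_iff.2 ⟨u⟩
    omega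
  rw [h1]
  push_cast
  rw [mul_div_mul_right _ _ (pow_ne_zero _ h0)]

end Pi

section Perm

variable {V : Type*} [Fintype V] [DecidableEq V]

lemma exists_perm_map_eq {S S' : Finset V} (h : S.card = S'.card) :
    ∃ ρ : Equiv.Perm V, S.map ρ.toEmbedding = S' := by
  have e : {x // x ∈ S} ≃ {x // x ∈ S'} := Finset.equivOfCardEq h
  refine ⟨e.extendSubtype, eq_of_subset_of_card_le ?_ ?_⟩
  · intro y hy
    obtain ⟨x, hx, rfl⟩ := Finset.mem_map.1 hy
    exact e.extendSubtype_mem x hx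
  · rw [card_map, h]

lemma pr_perm {c : ℕ} {Fam : Finset (Finset V)} (hF : ∀ T ∈ Fam, T.card = c) {S : Finset V}
    (hS : S.card = c) :
    pr (fun σ : Equiv.Perm V => ∃ T ∈ Fam, T.map σ.toEmbedding = S) =
      (Fam.card : ℝ) / (Fintype.card V).choose c := by
  classical
  set n : Finset V → ℕ := fun S =>
    (univ.filter fun σ : Equiv.Perm V => ∃ T ∈ Fam, T.map σ.toEmbedding = S).card with hn
  have h1 : ∀ S' ∈ powersetCard c (univ : Finset V), n S' = n S := by
    intro S' hS'
    rw [mem_powersetCard_univ] at hS'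
    obtain ⟨ρ, hρ⟩ := exists_perm_map_eq (hS'.trans hS.symm)
    refine card_bij' (fun σ _ => ρ * σ) (fun σ _ => ρ⁻¹ * σ) ?_ ?_ ?_ ?_
    · intro σ hσ
      simp only [mem_filter, mem_univ, true_and] at hσ ⊢
      obtain ⟨T, hT, h⟩ := hσ
      refine ⟨T, hT, ?_⟩
      rw [← hρ, ← h, Finset.map_map]
      rfl
    · intro σ hσ
      simp only [mem_filter, mem_univ, true_and] at hσ ⊢
      obtain ⟨T, hT, h⟩ := hσ
      refine ⟨T, hT, ?_⟩
      apply Finset.map_injective ρ.toEmbedding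
      rw [hρ, ← h, Finset.map_map]
      congr 1
      ext x
      simp
    · intro σ _; simp
    · intro σ _; simp
  have h2 : ∑ S' ∈ powersetCard c (univ : Finset V), n S' =
      Fintype.card (Equiv.Perm V) * Fam.card := by
    simp only [hn, card_filter]
    rw [sum_comm, ← smul_eq_mul, ← card_univ, ← sum_const]
    refine sum_congr rfl fun σ _ => ?_
    rw [← card_filter, ← card_map (s := Fam) (⟨Finset.map σ.toEmbedding, Finset.map_injective _⟩)]
    congr 1
    ext S'
    simp only [mem_filter, mem_powersetCard_univ, Finset.mem_map, Function.Embedding.coeFn_mk]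
    constructor
    · exact fun h => h.2
    · rintro ⟨T, hT, rfl⟩
      exact ⟨by rw [card_map, hF T hT], T, hT, rfl⟩
  rw [sum_congr rfl h1, sum_const, card_powersetCard, card_univ, smul_eq_mul] at h2
  have h3 : pr (fun σ : Equiv.Perm V => ∃ T ∈ Fam, T.map σ.toEmbedding = S) =
    (n S : ℝ) / Fintype.card (Equiv.Perm V) := by
      unfold pr; congr
  have hc : 0 < (Fintype.card V).choose c :=
    Nat.choose_pos (hS ▸ card_le_univ S)
  have h0 : (Fintype.card (Equiv.Perm V) : ℝ) ≠ 0 := by simp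
  rw [h3, div_eq_div_iff h0 (by positivity)]
  have : ((Fintype.card V).choose c : ℝ) * n S = Fintype.card (Equiv.Perm V) * Fam.card := by
    exact_mod_cast h2
  linarith

end Perm

end Prob

section

variable {U V Q W : Type*} [Fintype V] [DecidableEq V] [DecidableEq Q]
  [Fintype W] [DecidableEq W] {r t : ℕ} {h : U → V → Q} {x : V → Q} {b : W → V × Q}
  {π : U → Equiv.Perm V} {B : Finset (Bool → Finset V)} {N : Finset (Finset V)}
  {E : Bool → Finset W}

/-- The positions of a block whose vertices lie in the copy of a codeword. -/
def near (h : U → V → Q) (b : W → V × Q) (u : U) : Finset W :=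
  univ.filter fun k => h u (b k).1 = (b k).2

omit [Fintype V] [DecidableEq V] [DecidableEq W] in
lemma mem_near {u : U} {k : W} : k ∈ near h b u ↔ h u (b k).1 = (b k).2 := by
  simp [near]

omit [DecidableEq V] [DecidableEq W] in
lemma card_near_le (hb : ∀ k, (b k).2 = x (b k).1) (hinj : Function.Injective fun k => (b k).1)
    (u : U) : (near h b u).card ≤ (hit h x u).card := by
  refine card_le_card_of_injOn (fun k => (b k).1) ?_ hinj.injOn
  intro k hk
  have := mem_near.1 (mem_coe.1 hk)
  rw [mem_coe, mem_hit, ← hb, this]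

/-- Two codewords whose copies may conflict with a block close to neither of them. -/
structure Relevant (t : ℕ) (h : U → V → Q) (x : V → Q) (u u' : U) : Prop where
  ne : u ≠ u'
  left : (hit h x u).card < t
  right : (hit h x u').card < t
  far : 2 * t ≤ (hit h x u ∪ hit h x u').card + (agr h u u').card

/-- Some edge in the copy of `u` and some edge in the copy of `u'` form, together with an edge of
the block, a forbidden configuration. -/
def Conf (r t : ℕ) (E : Bool → Finset W) (B : Finset (Bool → Finset V)) (h : U → V → Q)
    (b : W → V × Q) (π : U → Equiv.Perm V) (u u' : U) : Prop :=
  ∃ p ∈ B, ∃ p' ∈ B, ∃ i j k, (blk E b i ∪ (p j).map (codeEmb h π u) ∪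
    (p' k).map (codeEmb h π u')).card + 2 * t ≤ 3 * r

omit [Fintype V] [Fintype W] [DecidableEq W] in
lemma card_blk (hE : ∀ i, (E i).card = r) (hb : Function.Injective b) (i : Bool) :
    (blk E b i).card = r := by
  rw [blk, card_image_of_injective _ hb, hE]

omit [Fintype W] [DecidableEq W] in
lemma conf_spec (hx : IsGeneric t h x)
    {S₁ S₂ : Finset V} (h₁ : S₁.card = r) (h₂ : S₂.card = r) {M : Finset (V × Q)}
    (hM : M.card = r) (hM' : M ⊆ univ.map ⟨fun y => (y, x y), fun _ _ hy => congrArg Prod.fst hy⟩)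
    {u u' : U} (hne : u ≠ u')
    (hc : (M ∪ S₁.map (codeEmb h π u) ∪ S₂.map (codeEmb h π u')).card + 2 * t ≤ 3 * r) :
    2 * t ≤ (hit h x u ∪ hit h x u').card + (agr h u u').card ∧
    (∀ y ∈ hit h x u ∪ hit h x u', (y, x y) ∈ M) ∧
    (∀ y ∈ hit h x u ∪ agr h u u', (π u).symm y ∈ S₁) ∧
    (∀ y ∈ hit h x u' ∪ agr h u u', (π u').symm y ∈ S₂) := by
  set f₁ := S₁.map (codeEmb h π u) with hf₁
  set f₂ := S₂.map (codeEmb h π u') with hf₂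
  set g : V ↪ V × Q := ⟨fun y => (y, x y), fun y y' hy => congrArg Prod.fst hy⟩ with hg
  set g' : V ↪ V × Q := ⟨fun y => (y, h u y), fun y y' hy => congrArg Prod.fst hy⟩ with hg'
  have e1 := card_union_add_card_inter M (f₁ ∪ f₂)
  have e2 := card_union_add_card_inter f₁ f₂
  have e3 : f₁.card = r := by rw [hf₁, card_map, h₁]
  have e4 : f₂.card = r := by rw [hf₂, card_map, h₂]
  rw [union_assoc] at hc
  have s1 : M ∩ (f₁ ∪ f₂) ⊆ (hit h x u ∪ hit h x u').map g := by
    intro z hz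
    rw [mem_inter, mem_union] at hz
    obtain ⟨y, -, rfl⟩ := Finset.mem_map.1 (hM' hz.1)
    refine mem_map_of_mem _ ?_
    rw [mem_union, mem_hit, mem_hit]
    exact hz.2.imp (fun h => (mem_map_codeEmb.1 h).2) (fun h => (mem_map_codeEmb.1 h).2)
  have s2 : f₁ ∩ f₂ ⊆ (agr h u u').map g' := by
    rintro ⟨y, z⟩ hz
    rw [mem_inter] at hz
    have z1 := (mem_map_codeEmb.1 hz.1).2
    have z2 := (mem_map_codeEmb.1 hz.2).2
    simp only at z1 z2
    rw [Finset.mem_map]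
    exact ⟨y, mem_agr.2 (z1.trans z2.symm), Prod.ext rfl z1⟩
  have c1 := card_le_card s1
  have c2 := card_le_card s2
  rw [card_map] at c1 c2
  have c3 := hx.two u u' hne
  have q1 := eq_of_subset_of_card_le s1 (by rw [card_map]; omega)
  have q2 := eq_of_subset_of_card_le s2 (by rw [card_map]; omega)
  have m1 : ∀ y ∈ hit h x u ∪ hit h x u', (y, x y) ∈ M ∩ (f₁ ∪ f₂) := fun y hy => by
    rw [q1]; exact mem_map_of_mem g hy
  have m2 : ∀ y ∈ agr h u u', (y, h u y) ∈ f₁ ∩ f₂ := fun y hy => by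
    rw [q2]; exact mem_map_of_mem g' hy
  have a1 : ∀ y ∈ agr h u u', (π u).symm y ∈ S₁ := fun y hy =>
    (mem_map_codeEmb.1 (mem_inter.1 (m2 y hy)).1).1
  have a2 : ∀ y ∈ agr h u u', (π u').symm y ∈ S₂ := fun y hy =>
    (mem_map_codeEmb.1 (mem_inter.1 (m2 y hy)).2).1
  refine ⟨by omega, fun y hy => (mem_inter.1 (m1 y hy)).1, ?_, ?_⟩
  · intro y hy
    rcases mem_union.1 hy with hy | hy
    · rcases mem_union.1 (mem_inter.1 (m1 y (mem_union_left _ hy))).2 with h3 | h3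
      · exact (mem_map_codeEmb.1 h3).1
      · exact a1 y (mem_agr.2 ((mem_hit.1 hy).trans (mem_map_codeEmb.1 h3).2.symm))
    · exact a1 y hy
  · intro y hy
    rcases mem_union.1 hy with hy | hy
    · rcases mem_union.1 (mem_inter.1 (m1 y (mem_union_right _ hy))).2 with h3 | h3
      · exact a2 y (mem_agr.2 ((mem_map_codeEmb.1 h3).2.trans (mem_hit.1 hy).symm))
      · exact (mem_map_codeEmb.1 h3).1
    · exact a2 y hy

/-- The sets which may be moved onto the near positions of a codeword. -/
noncomputable def target (t : ℕ) (E : Bool → Finset W) (B : Finset (Bool → Finset V))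
    (N : Finset (Finset V)) (K : Finset W) : Finset (Finset V) :=
  open Classical in if ∃ i, K ⊆ E i then freeSets t B N else N

/-- The near positions of a codeword are occupied by an admissible set. -/
def Fits (t : ℕ) (E : Bool → Finset W) (B : Finset (Bool → Finset V)) (N : Finset (Finset V))
    (h : U → V → Q) (b : W → V × Q) (π : U → Equiv.Perm V) (u : U) : Prop :=
  ∃ T ∈ target t E B N (near h b u), T.map (codeEmb h π u) = (near h b u).image b

lemma card_hit_lt_of_conf (hx : IsGeneric t h x) (hb : ∀ k, (b k).2 = x (b k).1)
    (hinj : Function.Injective fun k => (b k).1)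
    (hX : ∀ u, (near h b u).card = t → Fits t E B N h b π u) {p : Bool → Finset V} (hp : p ∈ B)
    {u : U} {i j : Bool} (hM : ∀ y ∈ hit h x u, (y, x y) ∈ blk E b i)
    (hS : ∀ y ∈ hit h x u, (π u).symm y ∈ p j) : (hit h x u).card < t := by
  by_contra! hge
  have hu : (hit h x u).card = t := le_antisymm (hx.one u) hge
  have key : (hit h x u) ⊆ ((near h b u).filter fun k => k ∈ E i).image fun k => (b k).1 := by
    intro y hy
    obtain ⟨k, hk, hk'⟩ := mem_image.1 (hM y hy)
    refine mem_image.2 ⟨k, mem_filter.2 ⟨mem_near.2 ?_, hk⟩, by rw [hk']⟩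
    rw [hk']
    exact mem_hit.1 hy
  have c1 := (card_le_card key).trans card_image_le
  have c2 := card_near_le (h := h) hb hinj u
  have c3 := card_filter_le (near h b u) fun k => k ∈ E i
  have hnear : near h b u ⊆ E i := by
    have := eq_of_subset_of_card_le (filter_subset (fun k => k ∈ E i) (near h b u)) (by omega)
    exact fun k hk => filter_eq_self.1 this k hk
  obtain ⟨T, hT, hTe⟩ := hX u (by omega)
  rw [target, if_pos ⟨i, hnear⟩] at hT
  simp only [freeSets, mem_filter] at hT
  refine hT.2.2 p hp j fun y hy => ?_
  have := mem_map_of_mem (codeEmb h π u) hy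
  rw [hTe] at this
  obtain ⟨k, hk, hk'⟩ := mem_image.1 this
  have h4 := hS (π u y) (by
    rw [mem_hit]
    rw [mem_near, hb, hk'] at hk
    exact hk)
  simpa using h4

omit [DecidableEq W] in
lemma exists_near_eq (hx : IsGeneric t h x) (hb : ∀ k, (b k).2 = x (b k).1)
    (hinj : Function.Injective fun k => (b k).1)
    (hcov : ∀ J : Finset V, J.card = t → ∃ u, ∀ y ∈ J, h u y = x y) {K : Finset W}
    (hK : K.card = t) : ∃ u, near h b u = K := by
  obtain ⟨u, hu⟩ := hcov (K.image fun k => (b k).1) (by rw [card_image_of_injective _ hinj, hK])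
  have h1 : K ⊆ near h b u := by
    intro k hk
    rw [mem_near, hb]
    exact hu _ (mem_image_of_mem _ hk)
  exact ⟨u, (eq_of_subset_of_card_le h1 (by
    rw [hK]; exact (card_near_le hb hinj u).trans (hx.one u))).symm⟩

lemma addable_of [Fintype U] [Fintype Q] (hE : IsShape r t E) (hB : IsPacking r t B N)
    (hc : IsCode t h)
    (hx : IsGeneric t h x) (hb : ∀ k, (b k).2 = x (b k).1)
    (hinj : Function.Injective fun k => (b k).1)
    (hcov : ∀ J : Finset V, J.card = t → ∃ u, ∀ y ∈ J, h u y = x y)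
    (hX : ∀ u, (near h b u).card = t → Fits t E B N h b π u)
    (hY : ∀ u u', Relevant t h x u u' → ¬ Conf r t E B h b π u u') :
    Addable r t E (blowB (codeEmb h π) B) (blowN (codeEmb h π) N) b := by
  have hbi : Function.Injective b := fun k k' hk => hinj (congrArg Prod.fst hk)
  have hs := hc.isSparse π
  set g : V ↪ V × Q := ⟨fun y => (y, x y), fun y y' hy => congrArg Prod.fst hy⟩ with hg
  have hM : ∀ i, blk E b i ⊆ univ.map g := by
    intro i z hz
    obtain ⟨k, -, rfl⟩ := mem_image.1 hz
    exact Finset.mem_map.2 ⟨(b k).1, mem_univ _, Prod.ext rfl (hb k).symm⟩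
  refine ⟨hbi, ?_, ?_, ?_⟩
  · intro K hK i hi
    obtain ⟨u, rfl⟩ := exists_near_eq hx hb hinj hcov hK
    obtain ⟨T, hT, hTe⟩ := hX u hK
    rw [target, if_pos ⟨i, hi⟩] at hT
    simp only [freeSets, mem_filter, mem_powersetCard_univ] at hT
    rw [← hTe]
    simp only [freeSets, mem_filter, mem_powersetCard_univ, card_map]
    have hcard : t ≤ (T.map (codeEmb h π u)).card := by rw [card_map, hT.1]
    refine ⟨hT.1, ?_, ?_⟩
    · rw [mem_blowN]
      rintro ⟨u', S, hS, hST⟩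
      obtain rfl := hs.eq_of_card_le hcard subset_rfl hST.ge
      exact hT.2.1 (Finset.map_injective _ hST ▸ hS)
    · intro p hp j hj
      obtain ⟨u', q, hq, rfl⟩ := mem_blowB.1 hp
      obtain rfl := hs.eq_of_card_le hcard subset_rfl hj
      exact hT.2.2 q hq j (map_subset_map.1 hj)
  · intro K hK hi
    obtain ⟨u, rfl⟩ := exists_near_eq hx hb hinj hcov hK
    obtain ⟨T, hT, hTe⟩ := hX u hK
    rw [target, if_neg (by push Not; exact hi)] at hT
    exact mem_blowN.2 ⟨u, T, hT, hTe⟩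
  · intro p hp p' hp' hne i j k
    obtain ⟨u, q, hq, rfl⟩ := mem_blowB.1 hp
    obtain ⟨u', q', hq', rfl⟩ := mem_blowB.1 hp'
    have c0 := card_blk hE.card_edge hbi i
    by_cases hu : u = u'
    · subst hu
      have hqq : q ≠ q' := by rintro rfl; exact hne rfl
      have e1 := card_union_add_card_inter (blk E b i)
        (mapBlk (codeEmb h π u) q j ∪ mapBlk (codeEmb h π u) q' k)
      have e2 := card_union_add_card_inter (mapBlk (codeEmb h π u) q j)
        (mapBlk (codeEmb h π u) q' k)
      have c1 : (mapBlk (codeEmb h π u) q j).card = r := by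
        rw [mapBlk, card_map, hB.card_edge q hq]
      have c2 : (mapBlk (codeEmb h π u) q' k).card = r := by
        rw [mapBlk, card_map, hB.card_edge q' hq']
      have c3 : (mapBlk (codeEmb h π u) q j ∩ mapBlk (codeEmb h π u) q' k).card < t := by
        rw [mapBlk, mapBlk, ← map_inter, card_map]
        exact (card_le_card (inter_subset_inter_left (subset_vert q' k))).trans_lt
          (hB.pair q hq q' hq' hqq j)
      have s1 : blk E b i ∩ (mapBlk (codeEmb h π u) q j ∪ mapBlk (codeEmb h π u) q' k) ⊆
          (hit h x u).map g := by
        intro z hz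
        rw [mem_inter, mem_union] at hz
        obtain ⟨y, -, rfl⟩ := Finset.mem_map.1 (hM i hz.1)
        refine mem_map_of_mem _ ?_
        rw [mem_hit]
        rcases hz.2 with h3 | h3
        · exact (mem_map_codeEmb.1 h3).2
        · exact (mem_map_codeEmb.1 h3).2
      have c4 := card_le_card s1
      rw [card_map] at c4
      have := hx.one u
      rw [union_assoc]
      omega
    · by_contra! hcon
      have hcon' : (blk E b i ∪ (q j).map (codeEmb h π u) ∪ (q' k).map (codeEmb h π u')).card +
        2 * t ≤ 3 * r := hcon
      obtain ⟨h1, h2, h3, h4⟩ := conf_spec hx (hB.card_edge q hq j) (hB.card_edge q' hq' k)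
        c0 (hM i) hu hcon'
      refine hY u u' ⟨hu, ?_, ?_, h1⟩ ⟨q, hq, q', hq', i, j, k, hcon'⟩
      · exact card_hit_lt_of_conf hx hb hinj hX hq (fun y hy => h2 y (mem_union_left _ hy))
          (fun y hy => h3 y (mem_union_left _ hy))
      · exact card_hit_lt_of_conf hx hb hinj hX hq' (fun y hy => h2 y (mem_union_right _ hy))
          (fun y hy => h4 y (mem_union_left _ hy))

end

section

variable {U V Q W : Type*} [Fintype V] [DecidableEq V] [DecidableEq Q]
  [Fintype W] [DecidableEq W] {r t : ℕ} {h : U → V → Q} {x : V → Q} {b : W → V × Q}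
  {π π' : U → Equiv.Perm V} {B : Finset (Bool → Finset V)} {N : Finset (Finset V)}
  {E : Bool → Finset W}

omit [Fintype V] [DecidableEq V] [DecidableEq Q] in
lemma codeEmb_congr {u : U} (hu : π u = π' u) : codeEmb h π u = codeEmb h π' u := by
  ext y <;> simp [codeEmb_apply, hu]

omit [Fintype V] [DecidableEq W] in
lemma map_codeEmb_eq_iff {u : U} {T : Finset V} :
    T.map (codeEmb h π u) = (near h b u).image b ↔
      T.map (π u).toEmbedding = (near h b u).image fun k => (b k).1 := by
  constructor
  · intro hT
    have := congrArg (Finset.image Prod.fst) hT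
    rw [image_image, map_eq_image, image_image] at this
    rw [map_eq_image]
    exact this
  · intro hT
    ext ⟨y, z⟩
    have hy : (π u).symm y ∈ T ↔ ∃ k, h u (b k).1 = (b k).2 ∧ (b k).1 = y := by
      have := congrArg (y ∈ ·) hT
      simp only [Finset.mem_map_equiv, mem_image, mem_near, eq_iff_iff] at this
      exact this
    rw [mem_map_codeEmb, hy, mem_image]
    simp only [mem_near]
    constructor
    · rintro ⟨⟨k, hk, rfl⟩, rfl⟩
      exact ⟨k, hk, Prod.ext rfl hk.symm⟩
    · rintro ⟨k, hk, hk'⟩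
      rw [hk'] at hk
      exact ⟨⟨k, by rw [hk']; exact hk, by rw [hk']⟩, hk⟩

lemma Fits.dependsOn (u : U) :
    DependsOn (fun π => Fits t E B N h b π u) (({u} : Finset U) : Set U) := by
  intro π π' hπ
  have := codeEmb_congr (h := h) (hπ u (by simp))
  simp only [Fits, this]

omit [Fintype V] [Fintype W] [DecidableEq W] in
lemma Conf.symm {u u' : U} (hc : Conf r t E B h b π u u') : Conf r t E B h b π u' u := by
  obtain ⟨p, hp, p', hp', i, j, k, hcard⟩ := hc
  refine ⟨p', hp', p, hp, i, k, j, ?_⟩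
  rwa [union_right_comm]

lemma Relevant.symm {u u' : U} (hr : Relevant t h x u u') : Relevant t h x u' u := by
  refine ⟨hr.ne.symm, hr.right, hr.left, ?_⟩
  have := hr.far
  rw [union_comm] at this
  convert this using 3
  ext i; simp [mem_agr, eq_comm]

lemma Relevant.eq (hx : IsGeneric t h x) {u u' u'' : U} (hr : Relevant t h x u u')
    (hr' : Relevant t h x u u'') : u' = u'' := by
  by_contra hne
  exact hx.three u u' u'' hr.ne hr'.ne hne hr.left hr.far hr'.far

variable [Fintype U] [DecidableEq U]

lemma le_pr_fits (hB : IsPacking r t B N) (hinj : Function.Injective fun k => (b k).1) {η : ℝ}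
    (hN : η * (Fintype.card V : ℝ) ^ t ≤ N.card)
    (hf : η * (Fintype.card V : ℝ) ^ t ≤ (freeSets t B N).card) {u : U}
    (hu : (near h b u).card = t) : η ≤ pr fun π => Fits t E B N h b π u := by
  have h1 : pr (fun π => Fits t E B N h b π u) = pr fun σ : Equiv.Perm V =>
      ∃ T ∈ target t E B N (near h b u),
        T.map σ.toEmbedding = (near h b u).image fun k => (b k).1 := by
    refine Eq.trans ?_ (pr_eval u _)
    simp only [Fits, map_codeEmb_eq_iff]
  have hS : ((near h b u).image fun k => (b k).1).card = t := by
    rw [card_image_of_injective _ hinj, hu]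
  rw [h1, pr_perm (c := t) ?_ hS]
  · have hpos : (0 : ℝ) < (Fintype.card V).choose t := by
      exact_mod_cast Nat.choose_pos (hS ▸ card_le_univ _)
    rw [le_div_iff₀ hpos]
    have h2 : η * (Fintype.card V : ℝ) ^ t ≤ (target t E B N (near h b u)).card := by
      unfold target
      split_ifs
      · exact hf
      · exact hN
    rcases le_total η 0 with h0 | h0
    · exact (mul_nonpos_of_nonpos_of_nonneg h0 hpos.le).trans (by positivity)
    · refine le_trans ?_ h2
      gcongr
      exact_mod_cast Nat.choose_le_pow _ _
  · intro T hT
    unfold target at hT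
    split_ifs at hT
    · simp only [freeSets, mem_filter, mem_powersetCard_univ] at hT
      exact hT.1
    · exact hB.card_res T hT

lemma pr_conf_le (hE : IsShape r t E) (hB : IsPacking r t B N)
    (hx : IsGeneric t h x) (hb : ∀ k, (b k).2 = x (b k).1)
    (hinj : Function.Injective fun k => (b k).1)
    (hm : 2 ^ (r + 2) * (t + 1) + t ≤ Fintype.card V) {u u' : U} (hr : Relevant t h x u u') :
    pr (fun π => Conf r t E B h b π u u') ≤ 1 / 2 := by
  classical
  have hbi : Function.Injective b := fun k k' hk => hinj (congrArg Prod.fst hk)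
  have hcard : t + 1 ≤ (hit h x u ∪ agr h u u').card := by
    have e1 := card_union_add_card_inter (hit h x u) (agr h u u')
    have e2 := card_union_add_card_inter (hit h x u) (hit h x u')
    have e3 : hit h x u ∩ agr h u u' ⊆ hit h x u ∩ hit h x u' := by
      intro i
      simp only [mem_inter, mem_hit, mem_agr]
      rintro ⟨h1, h2⟩
      exact ⟨h1, h2 ▸ h1⟩
    have e4 := card_le_card e3
    have := hr.far
    have := hr.right
    omega
  obtain ⟨Z, hZ, hZc⟩ := exists_subset_card_eq hcard
  set Fam : Finset (Finset V) :=
    (B ×ˢ (univ : Finset Bool)).biUnion fun e => powersetCard (t + 1) (e.1 e.2) with hFam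
  have h1 : pr (fun π => Conf r t E B h b π u u') ≤ pr fun σ : Equiv.Perm V =>
      ∃ T ∈ Fam, T.map σ.toEmbedding = Z := by
    refine le_trans (pr_mono fun π => ?_) (pr_eval u _).le
    rintro ⟨p, hp, p', hp', i, j, k, hc⟩
    have hM : blk E b i ⊆ univ.map ⟨fun y => (y, x y), fun _ _ hy => congrArg Prod.fst hy⟩ := by
      intro z hz
      obtain ⟨k, -, rfl⟩ := mem_image.1 hz
      exact Finset.mem_map.2 ⟨(b k).1, mem_univ _, Prod.ext rfl (hb k).symm⟩
    obtain ⟨-, -, h3, -⟩ := conf_spec hx (hB.card_edge p hp j) (hB.card_edge p' hp' k)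
        (card_blk hE.card_edge hbi i) hM hr.ne hc
    refine ⟨Z.map (π u).symm.toEmbedding, ?_, ?_⟩
    · rw [hFam, mem_biUnion]
      refine ⟨(p, j), by simp [hp], ?_⟩
      rw [mem_powersetCard, card_map]
      refine ⟨fun y hy => ?_, hZc⟩
      obtain ⟨z, hz, rfl⟩ := Finset.mem_map.1 hy
      exact h3 z (hZ hz)
    · rw [Finset.map_map]
      ext z; simp
  refine h1.trans ?_
  rw [pr_perm (c := t + 1) ?_ hZc]
  · have h2 : Fam.card ≤ B.card * 2 ^ (r + 1) := by
      refine card_biUnion_le.trans ?_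
      refine (sum_le_card_nsmul _ _ (2 ^ r) ?_).trans_eq ?_
      · intro e he
        rw [card_powersetCard, hB.card_edge _ (mem_product.1 he).1]
        exact Nat.choose_le_two_pow _ _
      · rw [card_product, smul_eq_mul]
        simp; ring
    have h3 := Nat.choose_succ_right_eq (Fintype.card V) t
    have h4 := hB.card_le_choose
    have hpos : 0 < (Fintype.card V).choose (t + 1) :=
      Nat.choose_pos (hZc ▸ card_le_univ _)
    rw [div_le_div_iff₀ (by exact_mod_cast hpos) (by norm_num)]
    have h5 : Fam.card * 2 ≤ (Fintype.card V).choose (t + 1) := by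
      refine Nat.le_of_mul_le_mul_right (c := t + 1) ?_ (by omega)
      rw [h3]
      calc Fam.card * 2 * (t + 1) ≤ ((Fintype.card V).choose t * 2 ^ (r + 1)) * 2 * (t + 1) := by
            gcongr
            exact h2.trans (Nat.mul_le_mul_right _ h4)
        _ = (Fintype.card V).choose t * (2 ^ (r + 2) * (t + 1)) := by ring
        _ ≤ _ := Nat.mul_le_mul_left _ (by omega)
    rw [one_mul]
    exact_mod_cast h5
  · intro T hT
    rw [hFam, mem_biUnion] at hT
    obtain ⟨e, -, he⟩ := hT
    exact (mem_powersetCard.1 he).2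

end

section

lemma exp_neg_two_mul_le {p : ℝ} (h0 : 0 ≤ p) (h1 : p ≤ 1 / 2) :
    Real.exp (-(2 * p)) ≤ 1 - p := by
  rw [Real.exp_neg, inv_le_iff_one_le_mul₀ (Real.exp_pos _)]
  have := Real.add_one_le_exp (2 * p)
  nlinarith [mul_nonneg h0 (by linarith : (0 : ℝ) ≤ 1 - 2 * p)]

variable {U V Q W : Type*} [Fintype V] [DecidableEq V] [DecidableEq Q]
  [Fintype W] [DecidableEq W] {r t : ℕ} {h : U → V → Q} {x : V → Q} {b : W → V × Q}
  {π : U → Equiv.Perm V} {B : Finset (Bool → Finset V)} {N : Finset (Finset V)}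
  {E : Bool → Finset W} [Fintype U] [DecidableEq U] [Fintype Q]

/-- Pairs of edges of a blown-up packing which form a forbidden configuration with an edge of a
block. -/
def confPairs {V : Type*} [DecidableEq V] (r t : ℕ) (E : Bool → Finset W)
    (B : Finset (Bool → Finset V)) (b : W → V) :
    Finset (((Bool → Finset V) × Bool) × ((Bool → Finset V) × Bool)) :=
  ((B ×ˢ univ) ×ˢ (B ×ˢ univ)).filter fun e => (e.1.1 e.1.2 ∩ e.2.1 e.2.2).card < t ∧
    ∃ i, (blk E b i ∪ e.1.1 e.1.2 ∪ e.2.1 e.2.2).card + 2 * t ≤ 3 * r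

open Classical in
/-- The pairs of codewords which are relevant for a word. -/
noncomputable def relPairs (t : ℕ) (h : U → V → Q) (x : V → Q) : Finset (Finset U) :=
  univ.filter fun D => ∃ u u', Relevant t h x u u' ∧ D = {u, u'}

/-- The copies of some two codewords of a set give rise to a conflict. -/
def ConfIn (r t : ℕ) (E : Bool → Finset W) (B : Finset (Bool → Finset V)) (h : U → V → Q)
    (b : W → V × Q) (D : Finset U) (π : U → Equiv.Perm V) : Prop :=
  ∃ u ∈ D, ∃ u' ∈ D, u ≠ u' ∧ Conf r t E B h b π u u'

omit [Fintype V] [Fintype W] [DecidableEq W] [Fintype U] [Fintype Q] [DecidableEq U] in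
lemma ConfIn.dependsOn (D : Finset U) :
    DependsOn (fun π => ¬ ConfIn r t E B h b D π) (D : Set U) := by
  intro π π' hπ
  simp only [eq_iff_iff, ConfIn, Conf]
  refine not_congr (exists_congr fun u => and_congr_right fun hu => exists_congr fun u' =>
    and_congr_right fun hu' => ?_)
  rw [codeEmb_congr (hπ u hu), codeEmb_congr (hπ u' hu')]

omit [Fintype Q] in
lemma pr_confIn_le (hE : IsShape r t E) (hB : IsPacking r t B N)
    (hx : IsGeneric t h x) (hb : ∀ k, (b k).2 = x (b k).1)
    (hinj : Function.Injective fun k => (b k).1)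
    (hm : 2 ^ (r + 2) * (t + 1) + t ≤ Fintype.card V) {D : Finset U} (hD : D ∈ relPairs t h x) :
    pr (ConfIn r t E B h b D) ≤ 1 / 2 := by
  simp only [relPairs, mem_filter, mem_univ, true_and] at hD
  obtain ⟨u, u', hr, rfl⟩ := hD
  refine le_trans (pr_mono fun π hπ => ?_) (pr_conf_le hE hB hx hb hinj hm hr)
  obtain ⟨w, hw, w', hw', hne, hc⟩ := hπ
  simp only [mem_insert, mem_singleton] at hw hw'
  rcases hw with rfl | rfl <;> rcases hw' with rfl | rfl
  · exact absurd rfl hne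
  · exact hc
  · exact hc.symm
  · exact absurd rfl hne

omit [Fintype W] [DecidableEq W] [Fintype Q] in
open Classical in
lemma card_confIn_le (htr : t ≤ r) (hB : IsPacking r t B N) (hc : IsCode t h) (π : U → Equiv.Perm V) :
    ((relPairs t h x).filter fun D => ConfIn r t E B h b D π).card ≤
      (confPairs r t E (blowB (codeEmb h π) B) b).card := by
  have hs := hc.isSparse π
  have key : ∀ D ∈ (relPairs t h x).filter fun D => ConfIn r t E B h b D π, ∃ e,
      e ∈ confPairs r t E (blowB (codeEmb h π) B) b ∧ ∃ u u', D = {u, u'} ∧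
        t ≤ (e.1.1 e.1.2).card ∧ t ≤ (e.2.1 e.2.2).card ∧
        e.1.1 e.1.2 ⊆ univ.map (codeEmb h π u) ∧ e.2.1 e.2.2 ⊆ univ.map (codeEmb h π u') := by
    intro D hD
    simp only [relPairs, mem_filter, mem_univ, true_and] at hD
    obtain ⟨⟨a, a', hr, rfl⟩, w, hw, w', hw', hne, p, hp, p', hp', i, j, k, hcf⟩ := hD
    have hpair : ({a, a'} : Finset U) = {w, w'} := by
      simp only [mem_insert, mem_singleton] at hw hw'
      rcases hw with rfl | rfl <;> rcases hw' with rfl | rfl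
      · exact absurd rfl hne
      · rfl
      · exact pair_comm _ _
      · exact absurd rfl hne
    have s1 : (p j).map (codeEmb h π w) ⊆ univ.map (codeEmb h π w) :=
      map_subset_map.2 (subset_univ _)
    have s2 : (p' k).map (codeEmb h π w') ⊆ univ.map (codeEmb h π w') :=
      map_subset_map.2 (subset_univ _)
    refine ⟨((mapBlk (codeEmb h π w) p, j), (mapBlk (codeEmb h π w') p', k)), ?_, w, w', hpair,
      ?_, ?_, s1, s2⟩
    · simp only [confPairs, mem_filter, mem_product, mem_univ, and_true, mem_blowB]
      exact ⟨⟨⟨w, p, hp, rfl⟩, ⟨w', p', hp', rfl⟩⟩,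
        (card_le_card (inter_subset_inter s1 s2)).trans_lt (hs.pair w w' hne), i, hcf⟩
    · simpa [mapBlk, hB.card_edge p hp] using htr
    · simpa [mapBlk, hB.card_edge p' hp'] using htr
  choose! f hf u u' hfu using key
  refine card_le_card_of_injOn f hf fun D hD D' hD' heq => ?_
  obtain ⟨h1, c1, c2, s1, s2⟩ := hfu D hD
  obtain ⟨h1', -, -, s1', s2'⟩ := hfu D' hD'
  rw [← heq] at s1' s2'
  rw [h1, h1', hs.eq_of_card_le c1 s1 s1', hs.eq_of_card_le c2 s2 s2']

open Classical in
lemma le_pr_addable (htr : t ≤ r) (hE : IsShape r t E) (hB : IsPacking r t B N) (hc : IsCode t h)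
    (hx : IsGeneric t h x) (hb : ∀ k, (b k).2 = x (b k).1)
    (hinj : Function.Injective fun k => (b k).1)
    (hcov : ∀ J : Finset V, J.card = t → ∃ u, ∀ y ∈ J, h u y = x y)
    (hm : 2 ^ (r + 2) * (t + 1) + t ≤ Fintype.card V) {η : ℝ} (hη0 : 0 ≤ η) (hη1 : η ≤ 1)
    (hN : η * (Fintype.card V : ℝ) ^ t ≤ N.card)
    (hf : η * (Fintype.card V : ℝ) ^ t ≤ (freeSets t B N).card) {S : ℝ}
    (hS : (∑ π : U → Equiv.Perm V, (confPairs r t E (blowB (codeEmb h π) B) b).card : ℕ) ≤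
      S * Fintype.card (U → Equiv.Perm V)) :
    η ^ (2 ^ Fintype.card W) * Real.exp (-(2 * S)) ≤
      pr fun π => Addable r t E (blowB (codeEmb h π) B) (blowN (codeEmb h π) N) b := by
  set I₁ := (univ : Finset U).filter fun u => (near h b u).card = t with hI₁
  set I₂ := relPairs t h x with hI₂
  have h1 : pr (fun π : U → Equiv.Perm V => ∀ i ∈ I₁.disjSum I₂,
      Sum.elim (fun u π => Fits t E B N h b π u) (fun D π => ¬ ConfIn r t E B h b D π) i π) ≤
      pr fun π => Addable r t E (blowB (codeEmb h π) B) (blowN (codeEmb h π) N) b := by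
    refine pr_mono fun π hπ => ?_
    refine addable_of hE hB hc hx hb hinj hcov ?_ ?_
    · intro u hu
      exact hπ (Sum.inl u) (by simp [hI₁, hu])
    · intro u u' hr hcf
      refine hπ (Sum.inr {u, u'}) ?_ ⟨u, by simp, u', by simp, hr.ne, hcf⟩
      simp only [inr_mem_disjSum, hI₂, relPairs, mem_filter, mem_univ, true_and]
      exact ⟨u, u', hr, rfl⟩
  refine le_trans ?_ h1
  have hrel : ∀ D ∈ I₂, ∀ w ∈ D, ∃ a, D = {w, a} ∧ Relevant t h x w a := by
    intro D hD w hw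
    simp only [hI₂, relPairs, mem_filter, mem_univ, true_and] at hD
    obtain ⟨u, u', hr, rfl⟩ := hD
    rcases mem_insert.1 hw with rfl | hw
    · exact ⟨u', rfl, hr⟩
    · rw [mem_singleton] at hw
      subst hw
      exact ⟨u, pair_comm _ _, hr.symm⟩
  have hclose : ∀ u ∈ I₁, ∀ D ∈ I₂, u ∉ D := by
    intro u hu D hD huD
    obtain ⟨a, -, hr⟩ := hrel D hD u huD
    have h2 := card_near_le (h := h) hb hinj u
    rw [(mem_filter.1 hu).2] at h2
    exact absurd hr.left (by omega)
  rw [pr_forall_of_dependsOn _ _ (Sum.elim (fun u => {u}) id), prod_disjSum]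
  · refine mul_le_mul ?_ ?_ (Real.exp_pos _).le (prod_nonneg fun _ _ => pr_nonneg)
    · have hcard : I₁.card ≤ 2 ^ Fintype.card W := by
        rw [← Fintype.card_finset, ← Finset.card_univ]
        refine card_le_card_of_injOn (near h b) (fun _ _ => mem_coe.2 (mem_univ _)) ?_
        intro u hu u' hu' heq
        by_contra hne
        have h2 : ((near h b u).image fun k => (b k).1).card = t := by
          rw [card_image_of_injective _ hinj]
          exact (mem_filter.1 hu).2
        have h3 : ((near h b u).image fun k => (b k).1) ⊆
            univ.filter fun y => h u y = h u' y := by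
          intro y hy
          obtain ⟨k, hk, rfl⟩ := mem_image.1 hy
          have hk' := hk
          rw [heq] at hk'
          simp [mem_near.1 hk, mem_near.1 hk']
        have h4 := card_le_card h3
        have h5 := hc.pair u u' hne
        omega
      refine (pow_le_pow_of_le_one hη0 hη1 hcard).trans ?_
      rw [← prod_const]
      refine prod_le_prod (fun _ _ => hη0) fun u hu => ?_
      exact le_pr_fits hB hinj hN hf (mem_filter.1 hu).2
    · have hsum : ∑ D ∈ I₂, pr (ConfIn r t E B h b D) ≤ S := by
        unfold pr
        rw [← sum_div, div_le_iff₀ (by exact_mod_cast Fintype.card_pos)]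
        refine le_trans ?_ hS
        rw [← Nat.cast_sum, Nat.cast_le]
        refine le_trans (le_of_eq ?_) (sum_le_sum fun π _ => card_confIn_le (b := b) (x := x) (E := E) htr hB hc π)
        exact sum_card_bipartiteAbove_eq_sum_card_bipartiteBelow
          (fun D π => ConfIn r t E B h b D π)
      calc Real.exp (-(2 * S)) ≤ Real.exp (∑ D ∈ I₂, -(2 * pr (ConfIn r t E B h b D))) := by
            rw [Real.exp_le_exp, sum_neg_distrib, ← mul_sum]
            linarith
        _ = ∏ D ∈ I₂, Real.exp (-(2 * pr (ConfIn r t E B h b D))) := Real.exp_sum _ _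
        _ ≤ _ := by
            refine prod_le_prod (fun _ _ => (Real.exp_pos _).le) fun D hD => ?_
            refine (exp_neg_two_mul_le pr_nonneg (pr_confIn_le hE hB hx hb hinj hm hD)).trans ?_
            rw [← pr_not]
            rfl
  · rintro (u | D) hi
    · exact Fits.dependsOn u
    · exact ConfIn.dependsOn D
  · rintro (u | D) hi (u' | D') hj hne
    · simp only [Sum.elim_inl, disjoint_singleton]
      rintro rfl; exact hne rfl
    · simp only [Sum.elim_inl, Sum.elim_inr, id, disjoint_singleton_left]
      exact hclose u (by simpa using hi) D' (by simpa using hj)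
    · simp only [Sum.elim_inl, Sum.elim_inr, id, disjoint_singleton_right]
      exact hclose u' (by simpa using hj) D (by simpa using hi)
    · simp only [Sum.elim_inr, id]
      rw [Finset.disjoint_left]
      intro w hw hw'
      obtain ⟨a, rfl, ha⟩ := hrel D (by simpa using hi) w hw
      obtain ⟨a', rfl, ha'⟩ := hrel D' (by simpa using hj) w hw'
      exact hne (by rw [ha.eq hx ha'])

end

section

variable {V Q W : Type*} [Fintype V] [DecidableEq V] [Fintype Q] [DecidableEq Q]
  [Fintype W] [DecidableEq W] {r t : ℕ} {B : Finset (Bool → Finset V)} {N : Finset (Finset V)}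
  {E : Bool → Finset W}

lemma IsPacking.sum_confPairs_le [Nonempty V] (hE : IsShape r t E) (hB : IsPacking r t B N)
    (htr : t ≤ r) :
    ∑ b : W → V, (confPairs r t E B b).card ≤
      2 * (2 ^ r * (2 * confConst r (Fintype.card W))) * Fintype.card V ^ Fintype.card W := by
  classical
  have hv := hE.card_univ
  have h1 : ∑ b : W → V, (confPairs r t E B b).card =
      ∑ f ∈ B ×ˢ (univ : Finset Bool), ∑ e ∈ (B ×ˢ (univ : Finset Bool)).filter
        (fun e => (f.1 f.2 ∩ e.1 e.2).card < t), ((univ : Finset (W → V)).filter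
          fun b => ∃ i, (blk E b i ∪ f.1 f.2 ∪ e.1 e.2).card + 2 * t ≤ 3 * r).card := by
    simp only [confPairs, card_filter, sum_filter, ite_and]
    rw [sum_comm, sum_product]
    refine sum_congr rfl fun f _ => sum_congr rfl fun e _ => ?_
    split_ifs <;> simp
  rw [h1]
  calc _ ≤ ∑ f ∈ B ×ˢ (univ : Finset Bool), 2 ^ r * (2 * confConst r (Fintype.card W)) *
        Fintype.card V ^ (Fintype.card W - t) := by
        refine sum_le_sum fun f hf => ?_
        exact hB.sum_conf_le hE htr (hB.card_edge f.1 (mem_product.1 hf).1 f.2)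
    _ ≤ (Fintype.card V ^ t * 2) * (2 ^ r * (2 * confConst r (Fintype.card W)) *
        Fintype.card V ^ (Fintype.card W - t)) := by
        rw [sum_const, card_product, smul_eq_mul]
        gcongr
        · exact hB.card_le
        · simp
    _ = 2 * (2 ^ r * (2 * confConst r (Fintype.card W))) *
        (Fintype.card V ^ t * Fintype.card V ^ (Fintype.card W - t)) := by ring
    _ = _ := by
        rw [← pow_add]
        congr 2
        omega

lemma card_not_injective_le :
    ((univ : Finset (W → V × Q)).filter fun b => ¬ Function.Injective fun k => (b k).1).card *
      Fintype.card V ≤ Fintype.card W ^ 2 * Fintype.card (V × Q) ^ Fintype.card W := by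
  classical
  have hsub : ((univ : Finset (W → V × Q)).filter fun b => ¬ Function.Injective fun k => (b k).1) ⊆
      (univ : Finset (W × W)).biUnion fun z => univ.filter fun b =>
        z.1 ≠ z.2 ∧ (b z.1).1 = (b z.2).1 := by
    intro b hb
    have hb := (mem_filter.1 hb).2
    simp only [Function.Injective] at hb
    push Not at hb
    obtain ⟨k, k', h1, h2⟩ := hb
    simp only [mem_biUnion, mem_filter, mem_univ, true_and]
    exact ⟨(k, k'), h2, h1⟩
  refine (Nat.mul_le_mul_right _ ((card_le_card hsub).trans card_biUnion_le)).trans ?_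
  rw [sum_mul]
  have : Fintype.card W ^ 2 * Fintype.card (V × Q) ^ Fintype.card W =
      ∑ z : W × W, Fintype.card (V × Q) ^ Fintype.card W := by
    simp [sq]
  rw [this]
  refine sum_le_sum fun z _ => ?_
  rw [← Fintype.card_fun, ← Finset.card_univ (α := V), ← card_product, ← Finset.card_univ]
  refine card_le_card_of_injOn (fun y => Function.update y.1 z.1 (y.2, (y.1 z.1).2))
    (fun _ _ => mem_coe.2 (mem_univ _)) ?_
  rintro ⟨b, y⟩ hb ⟨b', y'⟩ hb' heq
  simp only [coe_product, Set.mem_prod, coe_filter, mem_univ, true_and, Set.mem_ofPred_eq,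
    coe_univ, Set.mem_univ, and_true] at hb hb'
  simp only at heq
  have h1 := congrFun heq z.1
  simp only [Function.update_self, Prod.mk.injEq] at h1
  have h2 : ∀ k, k ≠ z.1 → b k = b' k := by
    intro k hk
    have := congrFun heq k
    rwa [Function.update_of_ne hk, Function.update_of_ne hk] at this
  refine Prod.ext (funext fun k => ?_) h1.1
  by_cases hk : k = z.1
  · subst hk
    refine Prod.ext ?_ h1.2
    simp only
    rw [hb.2, hb'.2, h2 _ hb.1.symm]
  · exact h2 k hk

omit [DecidableEq W] in
lemma card_extensions [AddCommGroup Q] {g : W → V}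
    (hg : Function.Injective g) (c : W → Q) :
    ((univ : Finset (V → Q)).filter fun x => ∀ k, x (g k) = c k).card *
      Fintype.card Q ^ Fintype.card W = Fintype.card Q ^ Fintype.card V := by
  classical
  let φ : (V → Q) →+ (W → Q) :=
    { toFun := fun x k => x (g k), map_zero' := rfl, map_add' := fun _ _ => rfl }
  have hφ : ∀ c, c ∈ Set.range φ := fun c => ⟨Function.extend g c 0, funext fun k => by
    simp [φ, hg.extend_apply]⟩
  have h1 : ∀ c' : W → Q, ((univ : Finset (V → Q)).filter fun x => φ x = c').card =
      ((univ : Finset (V → Q)).filter fun x => φ x = c).card := fun c' =>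
    AddMonoidHom.card_fiber_eq_of_mem_range φ (hφ c') (hφ c)
  have h2 := card_eq_sum_card_fiberwise (s := (univ : Finset (V → Q))) (f := φ)
    (t := (univ : Finset (W → Q))) (fun _ _ => mem_coe.2 (mem_univ _))
  simp only [h1, sum_const, Finset.card_univ, Fintype.card_fun, smul_eq_mul] at h2
  rw [h2, mul_comm]
  congr 2
  ext x
  simp [φ, funext_iff]

open Classical in
lemma card_no_extension_le [AddCommGroup Q] {P : (V → Q) → Prop}
    (hP : 4 * ((univ : Finset (V → Q)).filter fun x => ¬ P x).card ≤
      Fintype.card Q ^ Fintype.card V) :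
    4 * ((univ : Finset (W → V × Q)).filter fun b => (Function.Injective fun k => (b k).1) ∧
      ∀ x, (∀ k, x (b k).1 = (b k).2) → ¬ P x).card ≤
      Fintype.card (V × Q) ^ Fintype.card W := by
  have hq : 0 < Fintype.card Q := Fintype.card_pos
  set A := (univ : Finset (W → V × Q)).filter fun b => (Function.Injective fun k => (b k).1) ∧
      ∀ x, (∀ k, x (b k).1 = (b k).2) → ¬ P x with hA
  have h1 : A.card * Fintype.card Q ^ Fintype.card V =
      (A.sigma fun b => (univ : Finset (V → Q)).filter fun x =>
        ∀ k, x (b k).1 = (b k).2).card * Fintype.card Q ^ Fintype.card W := by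
    rw [card_sigma, sum_mul, ← smul_eq_mul, ← sum_const]
    refine sum_congr rfl fun b hb => ?_
    rw [hA, mem_filter] at hb
    rw [← card_extensions hb.2.1 fun k => (b k).2]
  have h2 : (A.sigma fun b => (univ : Finset (V → Q)).filter fun x =>
        ∀ k, x (b k).1 = (b k).2).card ≤
      Fintype.card V ^ Fintype.card W * ((univ : Finset (V → Q)).filter fun x => ¬ P x).card := by
    rw [← Fintype.card_fun, ← Finset.card_univ, ← card_product]
    refine card_le_card_of_injOn (fun y => ((fun k => (y.1 k).1), y.2)) ?_ ?_
    · rintro ⟨b, x⟩ hb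
      simp only [mem_coe, mem_sigma, hA, mem_filter, mem_univ, true_and] at hb
      simp only [mem_coe, mem_product, mem_filter, mem_univ, true_and]
      exact hb.1.2 x hb.2
    · rintro ⟨b, x⟩ hb ⟨b', x'⟩ hb' heq
      simp only [mem_coe, mem_sigma, mem_filter, mem_univ, true_and] at hb hb'
      simp only [Prod.mk.injEq] at heq
      obtain ⟨h1, rfl⟩ := heq
      have : b = b' := funext fun k => Prod.ext (congrFun h1 k) (by
        rw [← hb.2 k, ← hb'.2 k, congrFun h1 k])
      rw [this]
  refine Nat.le_of_mul_le_mul_right ?_ (pow_pos hq (Fintype.card V))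
  calc _ = 4 * (A.card * Fintype.card Q ^ Fintype.card V) := by ring
    _ ≤ 4 * ((Fintype.card V ^ Fintype.card W *
        ((univ : Finset (V → Q)).filter fun x => ¬ P x).card) *
          Fintype.card Q ^ Fintype.card W) := by
        rw [h1]
        gcongr
    _ = (Fintype.card V ^ Fintype.card W * Fintype.card Q ^ Fintype.card W) *
        (4 * ((univ : Finset (V → Q)).filter fun x => ¬ P x).card) := by ring
    _ ≤ _ := by
        rw [Fintype.card_prod, mul_pow]
        gcongr

end

section

variable {V W F : Type*} [Fintype V] [DecidableEq V] [Field F] [Fintype F] [DecidableEq F]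
  [Fintype W] [DecidableEq W] {r t : ℕ}

lemma exists_lin_eq {α : V → Fin t → F} (hc : IsCode t (lin α)) (x : V → F) {J : Finset V}
    (hJ : J.card = t) : ∃ u, ∀ y ∈ J, lin α u y = x y := by
  classical
  let φ : (Fin t → F) → (J → F) := fun u y => lin α u y
  have hinj : Function.Injective φ := by
    intro u u' heq
    by_contra hne
    have h1 := hc.pair u u' hne
    have h2 : J ⊆ univ.filter fun y => lin α u y = lin α u' y := by
      intro y hy
      simpa using congrFun heq ⟨y, hy⟩
    have := card_le_card h2
    omega
  have hbij := (Fintype.bijective_iff_injective_and_card φ).2 ⟨hinj, by simp [hJ]⟩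
  obtain ⟨u, hu⟩ := hbij.2 fun y => x y
  exact ⟨u, fun y hy => congrFun hu ⟨y, hy⟩⟩

end

/-- The constant bounding the expected number of conflicts. -/
def pairConst (r v : ℕ) : ℕ := 2 * (2 ^ r * (2 * confConst r v))

/-- The density gained by adding blocks to a blown-up packing. -/
noncomputable def gain (r v : ℕ) (η : ℝ) : ℝ :=
  η ^ 2 ^ v * Real.exp (-(2 * (4 * pairConst r v : ℕ))) / (8 * badConst r v)

section

variable {V W F : Type*} [Fintype V] [DecidableEq V] [Field F] [Fintype F] [DecidableEq F]
  [Fintype W] [DecidableEq W] {r t : ℕ} {B : Finset (Bool → Finset V)} {N : Finset (Finset V)}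
  {E : Bool → Finset W}

open Classical in
lemma exists_many_addable [Nonempty V] (hE : IsShape r t E) (hB : IsPacking r t B N) (ht : 1 ≤ t)
    (htr : t ≤ r)
    (hm : 2 ^ (r + 2) * (t + 1) + t ≤ Fintype.card V)
    (hm' : 4 * Fintype.card W ^ 2 ≤ Fintype.card V) {η : ℝ} (hη0 : 0 ≤ η) (hη1 : η ≤ 1)
    (hN : η * (Fintype.card V : ℝ) ^ t ≤ N.card)
    (hf : η * (Fintype.card V : ℝ) ^ t ≤ (freeSets t B N).card)
    (hq : 33 * 20 ^ Fintype.card V ≤ Fintype.card F) :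
    ∃ α : V → Fin t → F, ∃ π : (Fin t → F) → Equiv.Perm V, IsCode t (lin α) ∧
      η ^ 2 ^ Fintype.card W * Real.exp (-(2 * (4 * pairConst r (Fintype.card W) : ℕ))) *
        (Fintype.card (V × F) : ℝ) ^ Fintype.card W ≤
      4 * ((univ : Finset (W → V × F)).filter fun b =>
        Addable r t E (blowB (codeEmb (lin α) π) B) (blowN (codeEmb (lin α) π) N) b).card := by
  have hv := hE.card_univ
  have hv0 : 0 < Fintype.card W := by omega
  obtain ⟨α, hc, hgen⟩ := exists_good_code (F := F) (V := V) t hq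
  set h := lin α with hh
  set C := pairConst r (Fintype.card W) with hC
  have hC0 : 0 < C := by
    have : 0 < 3 * r + Fintype.card W := by omega
    rw [hC]; unfold pairConst confConst; positivity
  set Ω := (Fin t → F) → Equiv.Perm V with hΩ
  have hΩ0 : 0 < Fintype.card Ω := Fintype.card_pos
  set n := Fintype.card (V × F) with hn
  set v := Fintype.card W with hvdef
  set cf : (W → V × F) → ℕ := fun b =>
    ∑ π : Ω, (confPairs r t E (blowB (codeEmb h π) B) b).card with hcf
  set A₁ := (univ : Finset (W → V × F)).filter fun b => ¬ Function.Injective fun k => (b k).1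
  set A₂ := (univ : Finset (W → V × F)).filter fun b => (Function.Injective fun k => (b k).1) ∧
      ∀ x, (∀ k, x (b k).1 = (b k).2) → ¬ IsGeneric t h x with hA₂
  set A₃ := (univ : Finset (W → V × F)).filter fun b => 4 * C * Fintype.card Ω < cf b with hA₃
  have h1 : 4 * A₁.card ≤ n ^ v := by
    have := card_not_injective_le (V := V) (Q := F) (W := W)
    refine Nat.le_of_mul_le_mul_left ?_ (pow_pos hv0 2)
    calc v ^ 2 * (4 * A₁.card) = A₁.card * (4 * v ^ 2) := by ring
      _ ≤ A₁.card * Fintype.card V := Nat.mul_le_mul_left _ hm'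
      _ ≤ _ := this
  have h2 : 4 * A₂.card ≤ n ^ v := card_no_extension_le hgen
  have h3 : 4 * A₃.card ≤ n ^ v := by
    have h4 : ∑ b, cf b ≤ Fintype.card Ω * (C * n ^ v) := by
      rw [hcf, sum_comm, ← Finset.card_univ (α := Ω), ← smul_eq_mul]
      refine sum_le_card_nsmul _ _ _ fun π _ => ?_
      exact ((hc.isSparse π).isPacking hB).sum_confPairs_le hE htr
    have h5 : A₃.card * (4 * C * Fintype.card Ω) ≤ ∑ b, cf b := by
      rw [← smul_eq_mul]
      refine (card_nsmul_le_sum A₃ cf _ fun b hb => ?_).trans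
        (sum_le_sum_of_subset (subset_univ _))
      exact (mem_filter.1 hb).2.le
    refine Nat.le_of_mul_le_mul_left ?_ (Nat.mul_pos hC0 hΩ0)
    calc C * Fintype.card Ω * (4 * A₃.card) = A₃.card * (4 * C * Fintype.card Ω) := by ring
      _ ≤ _ := h5.trans h4
      _ = _ := by ring
  set G := (univ : Finset (W → V × F)) \ (A₁ ∪ A₂ ∪ A₃) with hG
  have h4 : n ^ v ≤ 4 * G.card := by
    have h5 : (univ : Finset (W → V × F)).card = n ^ v := by
      rw [Finset.card_univ, Fintype.card_fun]
    have h6 := le_card_sdiff (A₁ ∪ A₂ ∪ A₃) (univ : Finset (W → V × F))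
    have h7 := card_union_le (A₁ ∪ A₂) A₃
    have h8 := card_union_le A₁ A₂
    rw [← hG] at h6
    omega
  set κ := η ^ 2 ^ v * Real.exp (-(2 * (4 * C : ℕ))) with hκ
  have h5 : ∀ b ∈ G, κ * Fintype.card Ω ≤ ((univ : Finset Ω).filter fun π =>
      Addable r t E (blowB (codeEmb h π) B) (blowN (codeEmb h π) N) b).card := by
    intro b hb
    simp only [hG, Finset.mem_sdiff, mem_univ, true_and, mem_union, not_or] at hb
    obtain ⟨⟨b1, b2⟩, b3⟩ := hb
    have b1 : Function.Injective fun k => (b k).1 := by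
      by_contra hcon
      exact b1 (mem_filter.2 ⟨mem_univ _, hcon⟩)
    have b2 : ∃ x, (∀ k, x (b k).1 = (b k).2) ∧ IsGeneric t h x := by
      by_contra! hcon
      exact b2 (mem_filter.2 ⟨mem_univ _, b1, hcon⟩)
    have b3 : cf b ≤ 4 * C * Fintype.card Ω := by
      by_contra! hcon
      exact b3 (mem_filter.2 ⟨mem_univ _, hcon⟩)
    obtain ⟨x, hx, hxg⟩ := b2
    have := le_pr_addable htr hE hB hc hxg (fun k => (hx k).symm) b1
      (fun J hJ => exists_lin_eq hc x hJ) hm hη0 hη1 hN hf (S := (4 * C : ℕ))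
      (by exact_mod_cast b3)
    rw [pr, le_div_iff₀ (by exact_mod_cast hΩ0)] at this
    convert this
  have h6 : ∃ π : Ω, κ * G.card ≤ (G.filter fun b =>
      Addable r t E (blowB (codeEmb h π) B) (blowN (codeEmb h π) N) b).card := by
    by_contra! hcon
    have h7 := sum_lt_sum_of_nonempty (univ_nonempty (α := Ω)) fun π _ => hcon π
    have h9 := sum_card_bipartiteAbove_eq_sum_card_bipartiteBelow (s := univ) (t := G)
      (fun (π : Ω) b => Addable r t E (blowB (codeEmb h π) B) (blowN (codeEmb h π) N) b)
    simp only [bipartiteAbove, bipartiteBelow] at h9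
    rw [← Nat.cast_sum, h9, Nat.cast_sum, sum_const, Finset.card_univ, nsmul_eq_mul] at h7
    have h8 : ∑ b ∈ G, κ * Fintype.card Ω ≤ _ := sum_le_sum h5
    rw [sum_const, nsmul_eq_mul] at h8
    linarith
  obtain ⟨π, hπ⟩ := h6
  refine ⟨α, π, hc, ?_⟩
  have hκ0 : 0 ≤ κ := by positivity
  calc κ * (n : ℝ) ^ v ≤ κ * (4 * G.card) := by
        gcongr
        exact_mod_cast h4
    _ = 4 * (κ * G.card) := by ring
    _ ≤ _ := by
        gcongr
        refine hπ.trans ?_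
        gcongr
        exact subset_univ _

lemma exists_improvement (hE : IsShape r t E) (hB : IsPacking r t B N) (ht : 1 ≤ t)
    (htr : t ≤ r)
    (hm : 2 ^ (r + 2) * (t + 1) + t ≤ Fintype.card V)
    (hm' : 4 * Fintype.card W ^ 2 ≤ Fintype.card V) {η : ℝ} (hη0 : 0 ≤ η) (hη1 : η ≤ 1)
    (hN : η * (Fintype.card V : ℝ) ^ t ≤ N.card)
    (hf : η * (Fintype.card V : ℝ) ^ t ≤ (freeSets t B N).card)
    (hq : 33 * 20 ^ Fintype.card V ≤ Fintype.card F)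
    (hq' : 1 ≤ gain r (Fintype.card W) η * Fintype.card F) :
    ∃ (B' : Finset (Bool → Finset (V × F))) (N' : Finset (Finset (V × F))),
      IsPacking r t B' N' ∧ N'.card = Fintype.card F ^ t * N.card ∧
      (Fintype.card F : ℝ) ^ t * B.card + gain r (Fintype.card W) η * Fintype.card (V × F) ^ t ≤
        B'.card := by
  classical
  have hv := hE.card_univ
  have hV : 0 < Fintype.card V := by
    have : 0 < t := ht
    omega
  have : Nonempty V := Fintype.card_pos_iff.1 hV
  obtain ⟨α, π, hc, hadd⟩ := exists_many_addable hE hB ht htr hm hm' hη0 hη1 hN hf hq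
  have hs := hc.isSparse π
  set g := gain r (Fintype.card W) η with hg
  have hn : 0 < Fintype.card (V × F) := Fintype.card_pos
  have hbad : 0 < badConst r (Fintype.card W) := by
    have : 0 < Fintype.card W := by omega
    unfold badConst
    positivity
  have hg0 : 0 ≤ g := by rw [hg, gain]; positivity
  have hgn : 1 ≤ g * (Fintype.card (V × F) : ℝ) ^ t := by
    refine hq'.trans ?_
    gcongr
    rw [Fintype.card_prod]
    have : Fintype.card F ≤ (Fintype.card V * Fintype.card F) ^ t :=
      (Nat.le_mul_of_pos_left _ hV).trans (Nat.le_self_pow (by omega) _)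
    exact_mod_cast this
  obtain ⟨B', -, hB', hcard⟩ := (hs.isPacking hB).exists_extension hE ht htr
    (fun b hb => (mem_filter.1 hb).2) ⌊2 * (g * (Fintype.card (V × F) : ℝ) ^ t)⌋₊ (A := univ.filter
      fun b => Addable r t E (blowB (codeEmb (lin α) π) B) (blowN (codeEmb (lin α) π) N) b) (by
      have h1 : (⌊2 * (g * (Fintype.card (V × F) : ℝ) ^ t)⌋₊ : ℝ) ≤ _ :=
        Nat.floor_le (by linarith)
      rw [← Nat.cast_le (α := ℝ)]
      push_cast
      have h2 : (Fintype.card (V × F) : ℝ) ^ Fintype.card W = (Fintype.card (V × F) : ℝ) ^ t *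
          (Fintype.card (V × F) : ℝ) ^ (Fintype.card W - t) := by
        rw [← pow_add]
        congr 1
        omega
      have h3 : g * (8 * badConst r (Fintype.card W)) = η ^ 2 ^ Fintype.card W *
          Real.exp (-(2 * (4 * pairConst r (Fintype.card W) : ℕ))) := by
        rw [hg, gain, div_mul_cancel₀]
        positivity
      rw [← h3, h2] at hadd
      refine (mul_le_mul_of_nonneg_right h1 (by positivity)).trans ?_
      linarith)
  refine ⟨B', _, hB', (hs.card_blowN hB.card_res).trans (by simp), ?_⟩
  rw [hcard, hs.card_blowB hB htr]
  have h1 := Nat.lt_floor_add_one (2 * (g * (Fintype.card (V × F) : ℝ) ^ t))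
  push_cast
  simp only [Fintype.card_pi, prod_const, Nat.cast_pow, Finset.card_univ,
    Fintype.card_fin]
  simp only [Fintype.card_prod, Nat.cast_mul] at h1 hgn ⊢
  linarith

end

lemma eventually_le_choose (t : ℕ) {η : ℝ} (hη : 0 < η) :
    ∀ᶠ m : ℕ in atTop, (1 / t.factorial - η) * (m : ℝ) ^ t ≤ m.choose t := by
  have h1 : Tendsto (fun n : ℕ => (n : ℝ) * (1 / n)) atTop (nhds 1) := by
    refine tendsto_const_nhds.congr' ?_
    filter_upwards [eventually_gt_atTop 0] with n hn
    have : (n : ℝ) ≠ 0 := by positivity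
    field_simp
  have h2 := ProbabilityTheory.tendsto_choose_mul_pow_atTop t h1
  rw [one_pow] at h2
  filter_upwards [h2.eventually_const_le (sub_lt_self _ hη), eventually_gt_atTop 0] with n hn hn0
  have : (0 : ℝ) < n := by positivity
  rw [one_div_pow, mul_one_div, le_div_iff₀ (by positivity)] at hn
  exact hn

/-- The positions of the vertices of a block. -/
abbrev Pos (r t : ℕ) := Fin t ⊕ (Bool × Fin (r - t))

lemma exists_isShape {r t : ℕ} (htr : t ≤ r) : ∃ E : Bool → Finset (Pos r t), IsShape r t E := by
  refine ⟨fun i => univ.disjSum ({i} ×ˢ univ), ⟨fun i => ?_, ?_, ?_⟩⟩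
  · simp [card_disjSum, htr]
  · have : ((univ : Finset (Fin t)).disjSum (({false} : Finset Bool) ×ˢ (univ : Finset (Fin (r - t))))) ∩
      (univ.disjSum ({true} ×ˢ univ)) = univ.disjSum ∅ := by
      ext (x | ⟨x, y⟩)
      · simp
      · cases x <;> simp
    rw [this]
    simp
  · ext (x | ⟨x, y⟩)
    · simp
    · cases x <;> simp

/-- The densities of packings on at least `m₀` vertices with reservoirs of a prescribed size. -/
def densities (r t m₀ : ℕ) (η : ℝ) : Set ℝ :=
  {x | ∃ (V : Type) (_ : Fintype V) (_ : DecidableEq V) (B : Finset (Bool → Finset V))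
    (N : Finset (Finset V)), IsPacking r t B N ∧ m₀ ≤ Fintype.card V ∧
    η * (Fintype.card V : ℝ) ^ t ≤ N.card ∧ N.card ≤ 2 * η * (Fintype.card V : ℝ) ^ t ∧
    x * (Fintype.card V : ℝ) ^ t = B.card}

lemma densities_le_one {r t m₀ : ℕ} (hm₀ : 0 < m₀) {η x : ℝ} (hx : x ∈ densities r t m₀ η) :
    x ≤ 1 := by
  obtain ⟨V, _, _, B, N, hB, hV, -, -, hx⟩ := hx
  have h1 : (0 : ℝ) < (Fintype.card V : ℝ) ^ t := by
    have : 0 < Fintype.card V := by omega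
    positivity
  have h2 : (B.card : ℝ) ≤ (Fintype.card V : ℝ) ^ t := by exact_mod_cast hB.card_le
  rw [← hx] at h2
  exact (mul_le_iff_le_one_left h1).1 h2

lemma densities_nonempty {r t m₀ : ℕ} (ht : 1 ≤ t) {η : ℝ} (hη : 0 < η)
    (hη' : 3 * η ≤ 1 / t.factorial) : (densities r t m₀ η).Nonempty := by
  have h1 : ∀ᶠ m : ℕ in atTop, 1 / η ≤ m := by
    filter_upwards [eventually_ge_atTop ⌈1 / η⌉₊] with m hm
    exact Nat.ceil_le.1 hm
  obtain ⟨m, h2, h3, h4, h5⟩ := ((eventually_le_choose t hη).and (h1.and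
    ((eventually_ge_atTop m₀).and (eventually_ge_atTop 1)))).exists
  have h6 : 1 ≤ η * (m : ℝ) ^ t := by
    have : (m : ℝ) ≤ (m : ℝ) ^ t := le_self_pow₀ (by exact_mod_cast h5) (by omega)
    rw [div_le_iff₀ hη] at h3
    nlinarith
  have h7 : ⌈η * (m : ℝ) ^ t⌉₊ ≤ (powersetCard t (univ : Finset (Fin m))).card := by
    rw [card_powersetCard, Finset.card_univ, Fintype.card_fin, Nat.ceil_le]
    refine le_trans ?_ h2
    gcongr
    linarith
  obtain ⟨N, hN, hNc⟩ := exists_subset_card_eq h7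
  refine ⟨0, Fin m, inferInstance, inferInstance, ∅, N, ?_, by simpa, ?_, ?_, by simp⟩
  · exact ⟨by simp, by simp, fun T hT => (mem_powersetCard.1 (hN hT)).2, by simp, by simp, by simp,
      by simp⟩
  · rw [hNc, Fintype.card_fin]
    exact Nat.le_ceil _
  · rw [hNc, Fintype.card_fin]
    refine (Nat.ceil_lt_add_one (by positivity)).le.trans ?_
    linarith

lemma gain_pos {r v : ℕ} (hv : 0 < v) {η : ℝ} (hη : 0 < η) : 0 < gain r v η := by
  have : 0 < badConst r v := by
    unfold badConst
    positivity
  unfold gain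
  positivity

lemma exists_packing {r t : ℕ} (ht : 1 ≤ t) (htr : t ≤ r) {ε : ℝ} (hε : 0 < ε) :
    ∃ (V : Type) (_ : Fintype V) (_ : DecidableEq V) (B : Finset (Bool → Finset V))
      (N : Finset (Finset V)), IsPacking r t B N ∧ 1 ≤ Fintype.card V ∧
      (1 / t.factorial - ε) * (Fintype.card V : ℝ) ^ t ≤ B.card * (2 * r.choose t - 1) := by
  obtain ⟨E, hE⟩ := exists_isShape htr
  have hfac : (0 : ℝ) < t.factorial := by positivity
  have hfac1 : (1 : ℝ) ≤ t.factorial := by exact_mod_cast Nat.factorial_pos t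
  set η : ℝ := min (ε / 4) (1 / t.factorial / 3) with hη
  have hη0 : 0 < η := lt_min (by positivity) (by positivity)
  have hη1 : 4 * η ≤ ε := by linarith [min_le_left (ε / 4) (1 / t.factorial / 3 : ℝ)]
  have hη2 : 3 * η ≤ 1 / t.factorial := by linarith [min_le_right (ε / 4) (1 / t.factorial / 3 : ℝ)]
  have hη3 : η ≤ 1 := by
    have : (1 : ℝ) / t.factorial ≤ 1 := (div_le_one hfac).2 hfac1
    linarith
  obtain ⟨m₀, hm₀⟩ := eventually_atTop.1 ((eventually_le_choose t hη0).and
    ((eventually_ge_atTop (2 ^ (r + 2) * (t + 1) + t)).and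
    ((eventually_ge_atTop (4 * Fintype.card (Pos r t) ^ 2)).and (eventually_ge_atTop 1))))
  have hm₀1 : 0 < m₀ := (hm₀ m₀ le_rfl).2.2.2
  set v := Fintype.card (Pos r t) with hv
  have hv0 : 0 < v := by
    have := hE.card_univ
    omega
  have hg := gain_pos (r := r) hv0 hη0
  set g := gain r v η with hgdef
  have hbdd : BddAbove (densities r t m₀ η) := ⟨1, fun x hx => densities_le_one hm₀1 hx⟩
  obtain ⟨x, hx, hxS⟩ := exists_lt_of_lt_csSup (densities_nonempty (r := r) (m₀ := m₀) ht hη0 hη2)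
    (sub_lt_self (sSup (densities r t m₀ η)) hg)
  obtain ⟨V, _, _, B, N, hB, hV, hN1, hN2, hxB⟩ := hx
  obtain ⟨c1, c2, c3, c4⟩ := hm₀ _ hV
  refine ⟨V, ‹_›, ‹_›, B, N, hB, c4, ?_⟩
  have hfree : ((freeSets t B N).card : ℝ) < η * (Fintype.card V : ℝ) ^ t := by
    by_contra! hf
    obtain ⟨p, hp1, hp⟩ := Nat.exists_infinite_primes (33 * 20 ^ Fintype.card V + ⌈1 / g⌉₊)
    have : Fact p.Prime := ⟨hp⟩
    have hp0 : (0 : ℝ) < p := by exact_mod_cast hp.pos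
    have hc : Fintype.card (ZMod p) = p := ZMod.card p
    obtain ⟨B', N', hB', hN', hcard⟩ := exists_improvement (F := ZMod p) hE hB ht htr c2 c3 hη0.le
      hη3 hN1 hf (by rw [hc]; omega) (by
        rw [hc]
        have : 1 / g ≤ p := Nat.ceil_le.1 (by omega)
        rw [div_le_iff₀ hg] at this
        linarith)
    rw [hc] at hcard hN'
    have hV0 : (0 : ℝ) < Fintype.card V := by exact_mod_cast c4
    have hN'' : (N'.card : ℝ) = (p : ℝ) ^ t * N.card := by exact_mod_cast hN'
    have hmem : (B'.card : ℝ) / (Fintype.card (V × ZMod p) : ℝ) ^ t ∈ densities r t m₀ η := by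
      refine ⟨V × ZMod p, inferInstance, inferInstance, B', N', hB', ?_, ?_, ?_, ?_⟩
      · rw [Fintype.card_prod, hc]
        exact hV.trans (Nat.le_mul_of_pos_right _ hp.pos)
      · rw [hN'', Fintype.card_prod, hc, Nat.cast_mul, mul_pow]
        calc _ = (p : ℝ) ^ t * (η * (Fintype.card V : ℝ) ^ t) := by ring
          _ ≤ _ := by gcongr
      · rw [hN'', Fintype.card_prod, hc, Nat.cast_mul, mul_pow]
        calc _ ≤ (p : ℝ) ^ t * (2 * η * (Fintype.card V : ℝ) ^ t) := by gcongr
          _ = _ := by ring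
      · rw [div_mul_cancel₀]
        have : 0 < Fintype.card (V × ZMod p) := Fintype.card_pos_iff.2
          ⟨((Fintype.card_pos_iff.1 c4).some, 0)⟩
        positivity
    have h1 := le_csSup hbdd hmem
    have h2 : x + g ≤ (B'.card : ℝ) / (Fintype.card (V × ZMod p) : ℝ) ^ t := by
      rw [Fintype.card_prod, hc, Nat.cast_mul, mul_pow] at hcard ⊢
      rw [le_div_iff₀ (by positivity)]
      rw [← hxB] at hcard
      linarith
    linarith
  have h1 : ((Fintype.card V).choose t : ℝ) ≤
      (freeSets t B N).card + N.card + B.card * (2 * r.choose t - 1) := by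
    have h2 := hB.choose_le
    have h3 : 1 ≤ 2 * r.choose t := by
      have := Nat.choose_pos htr
      omega
    rw [← Nat.cast_le (α := ℝ)] at h2
    push_cast [Nat.cast_sub h3] at h2
    exact h2
  have h2 : 4 * η * (Fintype.card V : ℝ) ^ t ≤ ε * (Fintype.card V : ℝ) ^ t := by gcongr
  linarith

lemma exists_code {V : Type*} [Fintype V] [DecidableEq V] (t N : ℕ) (hN0 : N ≠ 0)
    (hN : ∀ p, p.Prime → p ∣ N → 33 * 20 ^ Fintype.card V ≤ p) :
    ∃ (U Q : Type) (_ : Fintype U) (_ : Fintype Q) (_ : DecidableEq Q) (h : U → V → Q),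
      IsCode t h ∧ Fintype.card Q = N ∧ Fintype.card U = N ^ t := by
  induction N using induction_on_primes with
  | zero => exact absurd rfl hN0
  | one =>
    exact ⟨Unit, Unit, inferInstance, inferInstance, inferInstance, fun _ _ => (),
      ⟨fun u u' h => absurd rfl h, fun u u' _ h => absurd rfl h⟩, rfl, by simp⟩
  | prime_mul p a hp ih =>
    obtain ⟨U, Q, _, _, _, h, hc, h1, h2⟩ := ih (right_ne_zero_of_mul hN0)
      fun q hq hqa => hN q hq (hqa.mul_left _)
    have : Fact p.Prime := ⟨hp⟩
    obtain ⟨α, hα, -⟩ := exists_good_code (F := ZMod p) (V := V) t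
      ((hN p hp (dvd_mul_right _ _)).trans (ZMod.card p).ge)
    exact ⟨(Fin t → ZMod p) × U, ZMod p × Q, inferInstance, inferInstance, inferInstance, _,
      hα.prod hc, by simp [h1], by simp [h2, mul_pow]⟩

section

variable {V V' : Type*} [DecidableEq V] [DecidableEq V'] {r t : ℕ} {B : Finset (Bool → Finset V)}
  {N : Finset (Finset V)}

/-- The edges of the blocks of a packing. -/
def edges (B : Finset (Bool → Finset V)) : Finset (Finset V) :=
  (B ×ˢ univ).image fun e => e.1 e.2

lemma IsPacking.card_edges (hB : IsPacking r t B N) (htr : t < r) :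
    (edges B).card = 2 * B.card := by
  rw [edges, card_image_of_injOn, card_product, Finset.card_univ, Fintype.card_bool, mul_comm]
  rintro ⟨p, i⟩ hp ⟨p', j⟩ hp' heq
  simp only [coe_product, coe_univ, Set.mem_prod, mem_coe, Set.mem_univ, and_true] at hp hp' heq
  have h1 : p = p' := hB.eq_of_subset hp hp' (T := p i) (i := i)
    (by rw [hB.card_edge p hp]; omega) Subset.rfl (heq ▸ subset_vert p' j)
  subst h1
  have h2 := hB.card_inter p hp
  have h3 := hB.card_edge p hp false
  rcases i with _ | _ <;> rcases j with _ | _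
  · rfl
  · rw [← heq, inter_self] at h2
    omega
  · rw [heq, inter_self] at h2
    omega
  · rfl

lemma IsPacking.lt_card_union (hB : IsPacking r t B N) {p p'' : Bool → Finset V} (hp : p ∈ B)
    (hp'' : p'' ∈ B) {i j k : Bool} (hij : p i ≠ p j) (hik : p'' k ≠ p i) (hjk : p'' k ≠ p j) :
    3 * r < (p i ∪ p j ∪ p'' k).card + 2 * t := by
  have hv : p i ∪ p j = vert p := by
    rcases i with _ | _ <;> rcases j with _ | _
    · exact absurd rfl hij
    · rfl
    · exact union_comm _ _
    · exact absurd rfl hij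
  have hne : p'' ≠ p := by
    rintro rfl
    rcases i with _ | _ <;> rcases j with _ | _ <;> rcases k with _ | _ <;> simp_all
  have h1 := hB.pair p'' hp'' p hp hne k
  have h2 := hB.card_vert hp
  have h3 := card_union_add_card_inter (vert p) (p'' k)
  rw [inter_comm, hB.card_edge p'' hp''] at h3
  rw [hv]
  omega

lemma IsPacking.isFree_edges (hB : IsPacking r t B N) (htr : t ≤ r) : IsFree (edges B) (3 * r - 2 * t) 3 := by
  rintro ⟨S, hS, hS3, hcard⟩
  obtain ⟨a, b, c, hab, hac, hbc, rfl⟩ := card_eq_three.1 hS3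
  have ha := hS (show a ∈ _ by simp)
  have hb := hS (show b ∈ _ by simp)
  have hc := hS (show c ∈ _ by simp)
  simp only [edges, mem_image, mem_product, mem_univ, and_true, Prod.exists] at ha hb hc
  obtain ⟨p, i, hp, rfl⟩ := ha
  obtain ⟨p', j, hp', rfl⟩ := hb
  obtain ⟨p'', k, hp'', rfl⟩ := hc
  have hsup : ({p i, p' j, p'' k} : Finset (Finset V)).sup id = p i ∪ p' j ∪ p'' k := by
    simp [sup_insert, union_assoc]
  rw [hsup] at hcard
  suffices h : 3 * r < (p i ∪ p' j ∪ p'' k).card + 2 * t by omega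
  by_cases h1 : p = p'
  · subst h1
    exact hB.lt_card_union hp hp'' hab hac.symm hbc.symm
  by_cases h2 : p = p''
  · subst h2
    rw [union_right_comm]
    exact hB.lt_card_union hp hp' hac hab.symm hbc
  by_cases h3 : p' = p''
  · subst h3
    rw [union_assoc, union_comm]
    exact hB.lt_card_union hp' hp hbc hab hac
  exact hB.triple p hp p' hp' p'' hp'' h1 h2 h3 i j k

lemma card_le_exNum {n s k : ℕ} {G : Finset (Finset (Fin n))} (hG : ∀ e ∈ G, e.card = r)
    (hG' : IsFree G s k) : G.card ≤ exNum r n s k := by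
  refine le_csSup ⟨Fintype.card (Finset (Fin n)), ?_⟩ ⟨G, hG, hG', rfl⟩
  rintro m ⟨G, -, -, rfl⟩
  exact card_le_univ G

lemma IsPacking.le_exNum [Fintype V] (hB : IsPacking r t B N) (htr : t < r) {n : ℕ}
    (hn : Fintype.card V ≤ n) : 2 * B.card ≤ exNum r n (3 * r - 2 * t) 3 := by
  obtain ⟨ι⟩ := Function.Embedding.nonempty_of_card_le (hn.trans (Fintype.card_fin n).ge)
  have hs : IsSparse t (fun _ : Unit => ι) :=
    ⟨fun _ _ h => absurd rfl h, fun _ _ _ h => absurd rfl h⟩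
  have hB' := hs.isPacking hB
  have h1 := hs.card_blowB hB htr.le
  rw [Fintype.card_unit, one_mul] at h1
  rw [← h1, ← hB'.card_edges htr]
  refine card_le_exNum ?_ (hB'.isFree_edges htr.le)
  intro e he
  simp only [edges, mem_image, mem_product, mem_univ, and_true, Prod.exists] at he
  obtain ⟨p, i, hp, rfl⟩ := he
  exact hB'.card_edge p hp i

lemma IsPacking.mul_le_exNum [Fintype V] (hB : IsPacking r t B N) (htr : t < r) {n c : ℕ}
    (hc0 : c ≠ 0) (hc : ∀ p, p.Prime → p ∣ c → 33 * 20 ^ Fintype.card V ≤ p)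
    (hn : Fintype.card V * c ≤ n) : 2 * B.card * c ^ t ≤ exNum r n (3 * r - 2 * t) 3 := by
  obtain ⟨U, Q, _, _, _, h, hcode, hQ, hU⟩ := exists_code (V := V) t c hc0 hc
  have hs := hcode.isSparse (fun _ => Equiv.refl V)
  have h1 := (hs.isPacking hB).le_exNum htr (n := n) (by rwa [Fintype.card_prod, hQ])
  rw [hs.card_blowB hB htr.le, hU] at h1
  calc _ = 2 * (c ^ t * B.card) := by ring
    _ ≤ _ := h1

lemma exNum_le (htr : t ≤ r) (n : ℕ) : exNum r n (3 * r - 2 * t) 3 ≤ 2 * n ^ t := by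
  classical
  refine csSup_le ⟨0, ∅, by simp, ?_, rfl⟩ ?_
  · rintro ⟨S, hS, hS3, -⟩
    rw [subset_empty.1 hS] at hS3
    simp at hS3
  · rintro m ⟨G, hG, hfree, rfl⟩
    have key : ∀ e ∈ G, ∃ T ⊆ e, T.card = t := fun e he =>
      exists_subset_card_eq (htr.trans (hG e he).ge)
    choose! f hf hft using key
    refine (card_le_mul_card_image G 2 (f := f) ?_).trans ?_
    · intro T hT
      by_contra! hcon
      obtain ⟨S, hS, hS3⟩ := exists_subset_card_eq (Nat.succ_le_of_lt hcon)
      refine hfree ⟨S, hS.trans (filter_subset _ _), hS3, ?_⟩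
      have hST : ∀ e ∈ S, e.card = r ∧ T ⊆ e ∧ T.card = t := by
        intro e he
        obtain ⟨h1, rfl⟩ := mem_filter.1 (hS he)
        exact ⟨hG e h1, hf e h1, hft e h1⟩
      have hTc : T.card = t := by
        obtain ⟨e, he⟩ := card_pos.1 (by omega : 0 < S.card)
        exact (hST e he).2.2
      have hsub : S.sup id ⊆ T ∪ S.biUnion fun e => e \ T := by
        intro x hx
        obtain ⟨e, he, hxe⟩ := Finset.mem_sup.1 hx
        simp only [mem_union, mem_biUnion, Finset.mem_sdiff]
        by_cases hxT : x ∈ T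
        · exact Or.inl hxT
        · exact Or.inr ⟨e, he, hxe, hxT⟩
      have h1 : (S.biUnion fun e => e \ T).card ≤ S.card * (r - t) := by
        refine card_biUnion_le_card_mul _ _ _ fun e he => ?_
        rw [card_sdiff_of_subset (hST e he).2.1, (hST e he).1, hTc]
      have h2 := (card_le_card hsub).trans (card_union_le _ _)
      rw [hS3] at h1
      omega
    · refine Nat.mul_le_mul_left 2 ?_
      refine le_trans (card_le_card (t := powersetCard t univ) ?_) ?_
      · intro T hT
        obtain ⟨e, he, rfl⟩ := mem_image.1 hT
        exact mem_powersetCard.2 ⟨subset_univ _, hft e he⟩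
      · rw [card_powersetCard, Finset.card_univ, Fintype.card_fin]
        exact Nat.choose_le_pow n t

lemma IsPacking.eventually_le [Fintype V] (hB : IsPacking r t B N) (htr : t < r)
    (hV : 1 ≤ Fintype.card V) {a : ℝ} (ha : a * (Fintype.card V : ℝ) ^ t < 2 * B.card) :
    ∀ᶠ n : ℕ in atTop, a ≤ (exNum r n (3 * r - 2 * t) 3 : ℝ) / (n : ℝ) ^ t := by
  set m := Fintype.card V with hm
  set M := (33 * 20 ^ m).factorial with hM
  have hM0 : 0 < M := Nat.factorial_pos _
  have hm0 : (0 : ℝ) < m := by exact_mod_cast hV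
  set β : ℝ := 2 * B.card / (m : ℝ) ^ t with hβ
  have h1 : Tendsto (fun n : ℕ => β * (1 - (m * (M + 1) : ℕ) / (n : ℝ)) ^ t) atTop
      (nhds (β * (1 - 0) ^ t)) :=
    ((tendsto_const_nhds.sub (tendsto_const_div_atTop_nhds_zero_nat _)).pow t).const_mul β
  have h2 : a < β * (1 - 0) ^ t := by
    rw [sub_zero, one_pow, mul_one, hβ, lt_div_iff₀ (by positivity)]
    exact ha
  filter_upwards [h1.eventually_const_le h2, eventually_ge_atTop (m * (M + 1))] with n hn hn'
  have hn0 : (0 : ℝ) < n := by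
    have : 0 < m * (M + 1) := by positivity
    exact_mod_cast this.trans_le hn'
  set c := M * ((n / m - 1) / M) + 1 with hc
  have hnm : 1 ≤ n / m := by
    rw [Nat.one_le_div_iff hV]
    nlinarith
  have hc1 : m * c ≤ n := by
    have e1 : M * ((n / m - 1) / M) ≤ n / m - 1 := Nat.mul_div_le _ _
    have e2 : c ≤ n / m := by omega
    exact (Nat.mul_le_mul_left _ e2).trans (Nat.mul_div_le _ _)
  have hc2 : n ≤ m * c + m * (M + 1) := by
    have e1 := Nat.lt_mul_div_succ (n / m - 1) hM0
    rw [mul_add, mul_one] at e1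
    have e2 := Nat.lt_mul_div_succ n hV
    have e3 : n / m + 1 ≤ c + (M + 1) := by omega
    rw [← mul_add]
    exact e2.le.trans (Nat.mul_le_mul_left _ e3)
  have h3 := hB.mul_le_exNum htr (n := n) (c := c) (by omega) (by
    intro p hp hpc
    by_contra! hlt
    have : p ∣ M := (hp.dvd_factorial).2 hlt.le
    have h4 : p ∣ 1 := (Nat.dvd_add_right (this.mul_right _)).1 hpc
    exact hp.one_lt.ne' (Nat.dvd_one.1 h4)) hc1
  refine hn.trans ?_
  rw [le_div_iff₀ (by positivity), mul_assoc, ← mul_pow, sub_mul, one_mul,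
    div_mul_cancel₀ _ hn0.ne']
  calc β * ((n : ℝ) - (m * (M + 1) : ℕ)) ^ t ≤ β * (m * c : ℝ) ^ t := by
        have e1 : (0 : ℝ) ≤ (n : ℝ) - (m * (M + 1) : ℕ) := by
          rw [sub_nonneg]
          exact_mod_cast hn'
        have e2 : (n : ℝ) - (m * (M + 1) : ℕ) ≤ m * c := by
          rw [sub_le_iff_le_add]
          exact_mod_cast hc2
        gcongr
    _ = 2 * B.card * (c : ℝ) ^ t := by
        rw [hβ, mul_pow, ← mul_assoc, div_mul_cancel₀]
        positivity
    _ ≤ _ := by exact_mod_cast h3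

end

end BES

/-- For all `2 ≤ t < r`, the liminf of `n⁻ᵗ f⁽ʳ⁾(n; 3r-2t, 3)` is at least
`2 / (t! (2 C(r,t) - 1))`. -/
theorem bes_k_eq_3_lower (r t : ℕ) (ht : 2 ≤ t) (htr : t < r) :
    2 / ((t.factorial : ℝ) * (2 * (r.choose t : ℝ) - 1)) ≤
      atTop.liminf (fun n : ℕ => (exNum r n (3 * r - 2 * t) 3 : ℝ) / (n : ℝ) ^ t) := by
  refine le_of_forall_lt fun a ha => ?_
  obtain ⟨a', haa', ha'⟩ := exists_between ha
  refine haa'.trans_le ?_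
  have hcob : IsCoboundedUnder (· ≥ ·) atTop (fun n : ℕ =>
      (exNum r n (3 * r - 2 * t) 3 : ℝ) / (n : ℝ) ^ t) := by
    refine IsBoundedUnder.isCoboundedUnder_ge (isBoundedUnder_of ⟨2, fun n => ?_⟩)
    refine div_le_of_le_mul₀ (by positivity) (by norm_num) ?_
    exact_mod_cast BES.exNum_le htr.le n
  have hD : (1 : ℝ) ≤ 2 * r.choose t - 1 := by
    have : (1 : ℝ) ≤ r.choose t := by exact_mod_cast Nat.choose_pos htr.le
    linarith
  set D : ℝ := 2 * r.choose t - 1 with hDdef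
  have hfac : (0 : ℝ) < t.factorial := by positivity
  have hε : 0 < (1 / t.factorial - a' * D / 2) / 2 := by
    rw [lt_div_iff₀ (by positivity)] at ha'
    have : a' * D / 2 < 1 / t.factorial := by
      rw [lt_div_iff₀ hfac]
      linarith
    linarith
  obtain ⟨V, _, _, B, N, hB, hV, hcard⟩ := BES.exists_packing (r := r) (by omega) htr.le hε
  refine le_liminf_of_le hcob (hB.eventually_le htr hV ?_)
  have hV0 : (0 : ℝ) < (Fintype.card V : ℝ) ^ t := by positivity
  rw [← hDdef] at hcard
  have h1 : a' * D / 2 * (Fintype.card V : ℝ) ^ t < B.card * D := by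
    refine lt_of_lt_of_le ?_ hcard
    gcongr
    linarith
  refine lt_of_mul_lt_mul_right ?_ (show 0 ≤ D by linarith)
  linarith
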